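/- arXiv:2103.08921 — 12 statements merged into one kernel-verified Lean document; each statement's English description precedes it below -/
import Mathlib

section
/- Let n, m ≥ 1 be integers and θ > 0. Suppose φ : ℝⁿ → ℝ is C⁴, its Hessian matrix D²φ(x) is positive definite for every x ∈ ℝⁿ, and φ satisfies trace((D²φ(x))⁻¹ · D²w_φ(x)) = 0 for all x ∈ ℝⁿ, where w_φ(x) = (det D²φ(x))^{-θ}. Define u : ℝⁿ × ℝᵐ → ℝ by u(x,y) = φ(x) + |y|²/2. Then D²u(x,y) is positive definite for every (x,y), and u satisfies trace((D²u(x,y))⁻¹ · D²w_u(x,y)) = 0 on ℝ^{n+m}, where w_u(x,y) = (det D²u(x,y))^{-θ}. In particular, if there exists a non-quadratic solution of the affine maximal type equation on ℝⁿ, then there exists a non-quadratic solution on ℝ^{n+m}. -/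
/-- The Hessian matrix of `u : (ι → ℝ) → ℝ` at `x`, with entries
`∂²u/∂xᵢ∂xⱼ (x)` given by the second iterated Fréchet derivative applied to
coordinate directions. -/
noncomputable def hessian {ι : Type*} [Fintype ι] [DecidableEq ι]
    (u : (ι → ℝ) → ℝ) (x : ι → ℝ) : Matrix ι ι ℝ :=
  Matrix.of fun i j => iteratedFDeriv ℝ 2 u x ![Pi.single i 1, Pi.single j 1]

/-- `f` is a quadratic polynomial. -/
def IsQuadratic {ι : Type*} [Fintype ι] (f : (ι → ℝ) → ℝ) : Prop :=
  ∃ (A : Matrix ι ι ℝ) (b : ι → ℝ) (c : ℝ),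
    ∀ x, f x = (∑ i, ∑ j, A i j * x i * x j) + (∑ i, b i * x i) + c

theorem hessian_add {ι : Type*} [Fintype ι] [DecidableEq ι] {f g : (ι → ℝ) → ℝ}
    (hf : ContDiff ℝ 2 f) (hg : ContDiff ℝ 2 g) (x : ι → ℝ) :
    hessian (fun y => f y + g y) x = hessian f x + hessian g x := by
  ext i j
  have h := fun_iteratedFDeriv_add_apply (i := 2) (x := x) hf.contDiffAt hg.contDiffAt
  simp only [hessian, Matrix.of_apply, Matrix.add_apply]
  rw [h]
  rfl

theorem hessian_comp_apply {ι κ : Type*} [Fintype ι] [DecidableEq ι] [Fintype κ] [DecidableEq κ]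
    {g : (ι → ℝ) → ℝ} (hg : ContDiff ℝ 2 g) (L : (κ → ℝ) →L[ℝ] (ι → ℝ)) (z : κ → ℝ) (i j : κ) :
    hessian (fun y => g (L y)) z i j =
      iteratedFDeriv ℝ 2 g (L z) ![L (Pi.single i 1), L (Pi.single j 1)] := by
  have h := L.iteratedFDeriv_comp_right hg z (i := 2) le_rfl
  simp only [hessian, Matrix.of_apply]
  change iteratedFDeriv ℝ 2 (g ∘ L) z _ = _
  rw [h, ContinuousMultilinearMap.compContinuousLinearMap_apply]
  congr 1
  ext k
  fin_cases k <;> rfl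

theorem hessian_comp_inl {ι κ : Type*} [Fintype ι] [DecidableEq ι] [Fintype κ] [DecidableEq κ]
    {g : (ι → ℝ) → ℝ} (hg : ContDiff ℝ 2 g) (z : ι ⊕ κ → ℝ) :
    hessian (fun y : ι ⊕ κ → ℝ => g fun i => y (Sum.inl i)) z =
      Matrix.fromBlocks (hessian g fun i => z (Sum.inl i)) 0 0 0 := by
  let L : (ι ⊕ κ → ℝ) →L[ℝ] (ι → ℝ) :=
    ContinuousLinearMap.pi fun i => ContinuousLinearMap.proj (Sum.inl i)
  have hl (i : ι) : L (Pi.single (Sum.inl i) 1) = Pi.single i 1 := by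
    ext k; simp [L, Pi.single_apply]
  have hr (j : κ) : L (Pi.single (Sum.inr j) 1) = 0 := by
    ext k; simp [L]
  ext a b
  refine (hessian_comp_apply hg L z a b).trans ?_
  rcases a with a | a <;> rcases b with b | b <;> simp only [hl, hr]
  · rfl
  · exact ContinuousMultilinearMap.map_coord_zero _ 1 rfl
  · exact ContinuousMultilinearMap.map_coord_zero _ 0 rfl
  · exact ContinuousMultilinearMap.map_coord_zero _ 0 rfl

theorem hessian_comp_inr {ι κ : Type*} [Fintype ι] [DecidableEq ι] [Fintype κ] [DecidableEq κ]
    {g : (κ → ℝ) → ℝ} (hg : ContDiff ℝ 2 g) (z : ι ⊕ κ → ℝ) :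
    hessian (fun y : ι ⊕ κ → ℝ => g fun j => y (Sum.inr j)) z =
      Matrix.fromBlocks 0 0 0 (hessian g fun j => z (Sum.inr j)) := by
  let L : (ι ⊕ κ → ℝ) →L[ℝ] (κ → ℝ) :=
    ContinuousLinearMap.pi fun j => ContinuousLinearMap.proj (Sum.inr j)
  have hl (i : ι) : L (Pi.single (Sum.inl i) 1) = 0 := by
    ext k; simp [L]
  have hr (j : κ) : L (Pi.single (Sum.inr j) 1) = Pi.single j 1 := by
    ext k; simp [L, Pi.single_apply]
  ext a b
  refine (hessian_comp_apply hg L z a b).trans ?_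
  rcases a with a | a <;> rcases b with b | b <;> simp only [hl, hr]
  · exact ContinuousMultilinearMap.map_coord_zero _ 0 rfl
  · exact ContinuousMultilinearMap.map_coord_zero _ 0 rfl
  · exact ContinuousMultilinearMap.map_coord_zero _ 1 rfl
  · rfl

theorem hessian_sum_sq_div_two {κ : Type*} [Fintype κ] [DecidableEq κ] (y : κ → ℝ) :
    hessian (fun y : κ → ℝ => (∑ j, y j ^ 2) / 2) y = 1 := by
  let B : (κ → ℝ) →L[ℝ] (κ → ℝ) →L[ℝ] ℝ :=
    ∑ j, (ContinuousLinearMap.proj (R := ℝ) (φ := fun _ : κ => ℝ) j).smulRight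
      (ContinuousLinearMap.proj (R := ℝ) (φ := fun _ : κ => ℝ) j)
  have hB : fderiv ℝ (fun y : κ → ℝ => (∑ j, y j ^ 2) / 2) = B := by
    funext y
    have hs : HasFDerivAt (fun y : κ → ℝ => ∑ j, y j ^ 2)
        (∑ j, (2 * y j) • ContinuousLinearMap.proj (R := ℝ) (φ := fun _ : κ => ℝ) j) y :=
      HasFDerivAt.fun_sum fun j _ => by
        simpa using (hasFDerivAt_apply (𝕜 := ℝ) j y).pow 2
    have hd := hs.mul_const (2⁻¹ : ℝ)
    simp only [← div_eq_mul_inv] at hd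
    rw [hd.fderiv]
    ext v
    simp [B, Finset.mul_sum]
    exact Finset.sum_congr rfl fun j _ => by ring
  ext i j
  simp only [hessian, Matrix.of_apply, iteratedFDeriv_two_apply, hB, ContinuousLinearMap.fderiv]
  simp [B, Matrix.one_apply, Pi.single_apply, eq_comm]

theorem contDiff_hessian_apply {ι : Type*} [Fintype ι] [DecidableEq ι] {f : (ι → ℝ) → ℝ}
    {k : ℕ∞} (hf : ContDiff ℝ (k + 2) f) (i j : ι) : ContDiff ℝ k fun x => hessian f x i j := by
  have h : ContDiff ℝ k (iteratedFDeriv ℝ 2 f) := hf.iteratedFDeriv_right le_rfl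
  exact (ContinuousMultilinearMap.apply ℝ (fun _ : Fin 2 => ι → ℝ) ℝ
    ![Pi.single i 1, Pi.single j 1]).contDiff.comp h

theorem contDiff_det_hessian_rpow {ι : Type*} [Fintype ι] [DecidableEq ι] {f : (ι → ℝ) → ℝ}
    {k : ℕ∞} (hf : ContDiff ℝ (k + 2) f) (hpos : ∀ x, (hessian f x).PosDef) (p : ℝ) :
    ContDiff ℝ k fun x => (hessian f x).det ^ p := by
  refine ContDiff.rpow_const_of_ne ?_ fun x => (hpos x).det_pos.ne'
  simp only [Matrix.det_apply]
  exact ContDiff.sum fun σ _ => (contDiff_prod fun i _ => contDiff_hessian_apply hf _ _).const_smul _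

theorem posDef_fromBlocks_one {ι κ : Type*} [Fintype ι] [DecidableEq ι] [Fintype κ]
    [DecidableEq κ] {A : Matrix ι ι ℝ} (hA : A.PosDef) :
    (Matrix.fromBlocks A 0 0 (1 : Matrix κ κ ℝ)).PosDef := by
  have : Invertible A := hA.isUnit.invertible
  have h : (Matrix.fromBlocks A 0 0 (1 : Matrix κ κ ℝ)).PosSemidef := by
    simpa using (Matrix.PosDef.fromBlocks₁₁ (0 : Matrix ι κ ℝ) (1 : Matrix κ κ ℝ) hA).2
      (by simpa using Matrix.PosSemidef.one)
  refine h.posDef_iff_det_ne_zero.2 ?_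
  simpa using hA.det_pos.ne'

theorem trace_inv_fromBlocks_one_mul {ι κ : Type*} [Fintype ι] [DecidableEq ι] [Fintype κ]
    [DecidableEq κ] {A : Matrix ι ι ℝ} (hA : IsUnit A) (W : Matrix ι ι ℝ) :
    ((Matrix.fromBlocks A 0 0 (1 : Matrix κ κ ℝ))⁻¹ * Matrix.fromBlocks W 0 0 0).trace =
      (A⁻¹ * W).trace := by
  have h : (Matrix.fromBlocks A 0 0 (1 : Matrix κ κ ℝ))⁻¹ = Matrix.fromBlocks A⁻¹ 0 0 1 := by
    refine Matrix.inv_eq_right_inv ?_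
    rw [Matrix.fromBlocks_multiply]
    simp [Matrix.mul_nonsing_inv _ ((Matrix.isUnit_iff_isUnit_det A).1 hA)]
  rw [h, Matrix.fromBlocks_multiply]
  simp [Matrix.trace]

/-- Adding `|y|²/2` in extra variables to a locally uniformly convex solution of the
affine maximal type equation on `ℝⁿ` produces a solution on `ℝ^{n+m}`; a non-quadratic
solution stays non-quadratic. -/
theorem stmt_2 (n m : ℕ) (hn : 1 ≤ n) (hm : 1 ≤ m) (θ : ℝ) (hθ : 0 < θ)
    (φ : (Fin n → ℝ) → ℝ) (hφ : ContDiff ℝ 4 φ)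
    (hpos : ∀ x, (hessian φ x).PosDef)
    (heq : ∀ x, ((hessian φ x)⁻¹
      * hessian (fun y => (hessian φ y).det ^ (-θ)) x).trace = 0)
    (u : (Fin n ⊕ Fin m → ℝ) → ℝ)
    (hu : ∀ z, u z = φ (fun i => z (Sum.inl i)) + (∑ j, (z (Sum.inr j)) ^ 2) / 2) :
    (∀ z, (hessian u z).PosDef) ∧
    (∀ z, ((hessian u z)⁻¹
      * hessian (fun y => (hessian u y).det ^ (-θ)) z).trace = 0) ∧
    (¬ IsQuadratic φ → ¬ IsQuadratic u) := by
  have hφ2 : ContDiff ℝ 2 φ := hφ.of_le (by norm_num)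
  have hH (z) : hessian u z =
      Matrix.fromBlocks (hessian φ fun i => z (Sum.inl i)) 0 0 1 := by
    have hq : ContDiff ℝ 2 fun y : Fin m → ℝ => (∑ j, y j ^ 2) / 2 := by fun_prop
    rw [funext hu, hessian_add (g := fun z : Fin n ⊕ Fin m → ℝ => (∑ j, z (Sum.inr j) ^ 2) / 2)
      (by fun_prop) (by fun_prop), hessian_comp_inl hφ2, hessian_comp_inr hq,
      hessian_sum_sq_div_two, Matrix.fromBlocks_add]
    simp
  have hw : ContDiff ℝ 2 fun x => (hessian φ x).det ^ (-θ) :=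
    contDiff_det_hessian_rpow (k := 2) (by norm_num; exact hφ) hpos _
  refine ⟨fun z => ?_, fun z => ?_, fun hn' ⟨A, b, c, h⟩ => hn' ?_⟩
  · rw [hH]
    exact posDef_fromBlocks_one (hpos _)
  · have hdet : (fun y => (hessian u y).det ^ (-θ)) =
        fun y => (hessian φ fun i => y (Sum.inl i)).det ^ (-θ) := by
      funext y
      simp [hH]
    rw [hdet, hH, hessian_comp_inl hw, trace_inv_fromBlocks_one_mul (hpos _).isUnit]
    exact heq _
  · refine ⟨A.toBlocks₁₁, fun i => b (Sum.inl i), c, fun x => ?_⟩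
    have hx := (hu (Sum.elim x 0)).symm.trans (h (Sum.elim x 0))
    simpa [Fintype.sum_sum_type, Matrix.toBlocks₁₁] using hx
end

section
/- Let N ≥ 3 be an integer and θ > 0. Then there exists δ > 0 such that there are no η₁, η₂ with 1 − δ ≤ η₁ < η₂ ≤ 1 and no continuously differentiable function ζ : [η₁, η₂] → ℝ with ζ(η₂) = 0 and ζ(η) < 0 for all η ∈ [η₁, η₂), satisfying for all η ∈ [η₁, η₂) the equation −ζ(η)ζ'(η) + (θ+1)ζ(η)²/η + ζ(η)·((2Nθ−(2N−1))η − (2Nθ−1)) + N·η·(η−1)·((Nθ−(N−1))η − (Nθ−1)) = 0. -/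
/-- For `N ≥ 3` and `θ > 0` the reduced radial equation (3.3) admits no negative
solution branch ending at a zero at `η₂` near `1` (type 3 solutions). -/
theorem stmt_5 (N : ℕ) (hN : 3 ≤ N) (θ : ℝ) (hθ : 0 < θ) :
    ∃ δ > (0:ℝ), ∀ η₁ η₂ : ℝ, 1 - δ ≤ η₁ → η₁ < η₂ → η₂ ≤ 1 →
      ∀ ζ : ℝ → ℝ, ContDiffOn ℝ 1 ζ (Set.Icc η₁ η₂) →
        ζ η₂ = 0 → (∀ η ∈ Set.Ico η₁ η₂, ζ η < 0) →
        ¬ (∀ η ∈ Set.Ico η₁ η₂,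
          -(ζ η * derivWithin ζ (Set.Icc η₁ η₂) η) + (θ + 1) * (ζ η) ^ 2 / η
          + ζ η * ((2 * (N:ℝ) * θ - (2 * (N:ℝ) - 1)) * η - (2 * (N:ℝ) * θ - 1))
          + (N:ℝ) * η * (η - 1)
            * (((N:ℝ) * θ - ((N:ℝ) - 1)) * η - ((N:ℝ) * θ - 1)) = 0) := by
  have hN' : (3:ℝ) ≤ N := by exact_mod_cast hN
  refine ⟨1 / 2, by norm_num, fun η₁ η₂ h₁ h₁₂ h₂ ζ hζ hζ₂ hneg heq => ?_⟩
  -- Every term besides `-ζ ζ'` is nonnegative, so `ζ` is antitone and cannot increase to zero.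
  have hanti : AntitoneOn ζ (Set.Icc η₁ η₂) := by
    refine antitoneOn_of_deriv_nonpos (convex_Icc η₁ η₂) hζ.continuousOn
      ((hζ.differentiableOn one_ne_zero).mono interior_subset) fun η hη => ?_
    rw [interior_Icc] at hη
    rw [← derivWithin_of_mem_nhds (Icc_mem_nhds hη.1 hη.2)]
    have hζη := hneg η ⟨hη.1.le, hη.2⟩
    have hode := heq η ⟨hη.1.le, hη.2⟩
    have hη_low : 1 / 2 ≤ η := by linarith [hη.1]
    have hη_up : η ≤ 1 := by linarith [hη.2]
    have hη_pos : 0 < η := by linarith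
    have hNθ : 0 ≤ (N:ℝ) * θ * (1 - η) := by
      have := sub_nonneg.2 hη_up
      positivity
    have hsq : 0 ≤ (θ + 1) * (ζ η) ^ 2 / η := by positivity
    have hlin : 0 ≤ ζ η * ((2 * (N:ℝ) * θ - (2 * (N:ℝ) - 1)) * η - (2 * (N:ℝ) * θ - 1)) :=
      mul_nonneg_of_nonpos_of_nonpos hζη.le (by nlinarith)
    have hsource : 0 ≤ (N:ℝ) * η * (η - 1)
        * (((N:ℝ) * θ - ((N:ℝ) - 1)) * η - ((N:ℝ) * θ - 1)) :=
      mul_nonneg_of_nonpos_of_nonpos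
        (mul_nonpos_of_nonneg_of_nonpos (by positivity) (by linarith)) (by nlinarith)
    by_contra! hderiv
    linarith [mul_neg_of_neg_of_pos hζη hderiv]
  have hle := hanti (Set.left_mem_Icc.2 h₁₂.le) (Set.right_mem_Icc.2 h₁₂.le) h₁₂.le
  linarith [hneg η₁ (Set.left_mem_Ico.2 h₁₂)]
end

section
/- Let k ≥ 2 be an integer, N = 2k, θ = (N+1)/(N+2), and C > 0. Then the function u(r) = C·r^{2k²} satisfies, for every r > 0, the radial affine maximal equation −u''''(r) + (θ+1)(u'''(r))²/u''(r) + 2(N−1)u'''(r)·((θ−1)u''(r)/u'(r) − θ/r) + (N−1)u''(r)·(u''(r)/u'(r) − 1/r)·(((N−1)θ−(N−2))·u''(r)/u'(r) − ((N−1)θ−1)/r) = 0 (in particular u'(r) > 0 and u''(r) > 0 for r > 0, so all quotients are defined). -/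
theorem deriv_const_mul_pow_succ (c : ℝ) (n : ℕ) :
    deriv (fun s : ℝ => c * s ^ (n + 1)) = fun s => c * (n + 1) * s ^ n := by
  funext s
  simp [mul_assoc]

/-- For `N = 2k` (`k ≥ 2`) and `θ = (N+1)/(N+2)`, the functions `u(r) = C·r^(2k²)`
solve the radial affine maximal equation for all `r > 0`, and are strictly
increasing and strictly convex there. -/
theorem stmt_6 (k : ℕ) (hk : 2 ≤ k) (N θ : ℝ) (hN : N = 2 * k)
    (hθ : θ = (N + 1) / (N + 2)) (C : ℝ) (hC : 0 < C)
    (u : ℝ → ℝ) (hu : ∀ s : ℝ, u s = C * s ^ (2 * k ^ 2)) (r : ℝ) (hr : 0 < r) :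
    0 < deriv u r ∧ 0 < iteratedDeriv 2 u r ∧
    -(iteratedDeriv 4 u r)
      + (θ + 1) * (iteratedDeriv 3 u r) ^ 2 / iteratedDeriv 2 u r
      + 2 * (N - 1) * iteratedDeriv 3 u r
        * ((θ - 1) * iteratedDeriv 2 u r / deriv u r - θ / r)
      + (N - 1) * iteratedDeriv 2 u r
        * (iteratedDeriv 2 u r / deriv u r - 1 / r)
        * (((N - 1) * θ - (N - 2)) * iteratedDeriv 2 u r / deriv u r
          - ((N - 1) * θ - 1) / r) = 0 := by
  obtain ⟨q, hq⟩ : ∃ q, 2 * k ^ 2 = q + 4 := Nat.exists_eq_add_of_le' (by nlinarith)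
  have hqk : (q : ℝ) = 2 * k ^ 2 - 4 := by
    have : (2 * k ^ 2 : ℝ) = q + 4 := by exact_mod_cast hq
    linarith
  have d1 : deriv u = fun s => C * (q + 4) * s ^ (q + 3) := by
    rw [show u = fun s => C * s ^ (q + 3 + 1) from funext fun s => by rw [hu, hq],
      deriv_const_mul_pow_succ]
    funext s
    push_cast
    ring
  have d2 : iteratedDeriv 2 u = fun s => C * (q + 4) * (q + 3) * s ^ (q + 2) := by
    rw [iteratedDeriv_succ, iteratedDeriv_one, d1, deriv_const_mul_pow_succ]
    funext s
    push_cast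
    ring
  have d3 : iteratedDeriv 3 u = fun s => C * (q + 4) * (q + 3) * (q + 2) * s ^ (q + 1) := by
    rw [iteratedDeriv_succ, d2, deriv_const_mul_pow_succ]
    funext s
    push_cast
    ring
  have d4 : iteratedDeriv 4 u =
      fun s => C * (q + 4) * (q + 3) * (q + 2) * (q + 1) * s ^ q := by
    rw [iteratedDeriv_succ, d3, deriv_const_mul_pow_succ]
  simp only [d1, d2, d3, d4]
  refine ⟨by positivity, by positivity, ?_⟩
  have e1 : ∀ t : ℝ, t * (C * (q + 4) * (q + 3) * r ^ (q + 2)) / (C * (q + 4) * r ^ (q + 3))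
      = t * (q + 3) / r := fun t => by
    field_simp
    ring
  have e1' : C * (q + 4) * (q + 3) * r ^ (q + 2) / (C * (q + 4) * r ^ (q + 3))
      = (q + 3) / r := by
    field_simp
    ring
  have e2 : (θ + 1) * (C * (q + 4) * (q + 3) * (q + 2) * r ^ (q + 1)) ^ 2
      / (C * (q + 4) * (q + 3) * r ^ (q + 2))
      = (θ + 1) * (C * (q + 4) * (q + 3) * (q + 2) ^ 2 * r ^ q) := by
    field_simp
    ring
  have key : -(q + 1 : ℝ) + (θ + 1) * (q + 2) + 2 * (N - 1) * ((θ - 1) * (q + 3) - θ)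
      + (N - 1) * (((N - 1) * θ - (N - 2)) * (q + 3) - ((N - 1) * θ - 1)) = 0 := by
    have hN2 : (2 * k + 2 : ℝ) ≠ 0 := by positivity
    rw [hθ, hN, hqk]
    field_simp
    ring
  rw [e1, e1, e1', e2]
  calc _ = C * (q + 4) * (q + 3) * (q + 2) * r ^ q *
        (-(q + 1 : ℝ) + (θ + 1) * (q + 2) + 2 * (N - 1) * ((θ - 1) * (q + 3) - θ)
      + (N - 1) * (((N - 1) * θ - (N - 2)) * (q + 3) - ((N - 1) * θ - 1))) := by
        field_simp
        ring
    _ = 0 := by rw [key, mul_zero]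
end

section
/- Let θ ≠ 1/2, λ ∈ ℝ, and let v be a twice continuously differentiable, strictly positive function on an interval I ⊆ ℝ satisfying −v''(r) + (θ+1)(v'(r))²/v(r) = λ·v(r)² for all r ∈ I. Then the function r ↦ ((v'(r))² − (2λ/(2θ−1))·v(r)³)·v(r)^{−2(θ+1)} is constant on I. -/
/-- A function with zero derivative within a convex set is constant on it. -/
theorem Convex.exists_const_of_hasDerivWithinAt_zero {f : ℝ → ℝ} {s : Set ℝ} (hs : Convex ℝ s)
    (hf : ∀ x ∈ s, HasDerivWithinAt f 0 s x) : ∃ c, ∀ x ∈ s, f x = c := by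
  rcases s.eq_empty_or_nonempty with rfl | ⟨a, ha⟩
  · exact ⟨0, by simp⟩
  · refine ⟨f a, fun x hx => ?_⟩
    have h := hs.norm_image_sub_le_of_norm_hasDerivWithin_le (C := 0) hf (by simp) ha hx
    rw [zero_mul, norm_le_zero_iff, sub_eq_zero] at h
    exact h

/-- The first integral has zero derivative along a positive solution of the first-order system
`v' = p`, `-p' + (θ + 1) p² / v = lam v²`. -/
theorem hasDerivWithinAt_firstIntegral {θ lam q r : ℝ} {v p : ℝ → ℝ} {s : Set ℝ}
    (hθ : θ ≠ 1 / 2) (hpos : 0 < v r) (hv : HasDerivWithinAt v (p r) s r)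
    (hp : HasDerivWithinAt p q s r)
    (hode : -q + (θ + 1) * p r ^ 2 / v r = lam * v r ^ 2) :
    HasDerivWithinAt
      (fun x => (p x ^ 2 - 2 * lam / (2 * θ - 1) * v x ^ 3) * v x ^ (-(2 * (θ + 1)))) 0 s r := by
  have hθ' : 2 * θ - 1 ≠ 0 := fun h => hθ (by linarith)
  have hne : v r ≠ 0 := hpos.ne'
  have hq : q = (θ + 1) * p r ^ 2 / v r - lam * v r ^ 2 := by linarith
  have h := ((hp.fun_pow 2).sub ((hv.fun_pow 3).const_mul (2 * lam / (2 * θ - 1)))).mul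
    (hv.rpow_const (p := -(2 * (θ + 1))) (Or.inl hne))
  refine h.congr_deriv ?_
  rw [hq, Real.rpow_sub_one hne]
  simp only [Pi.sub_apply]
  push_cast
  field_simp
  ring

/-- First integral for the 1-d nonlinear eigenvalue ODE `−v'' + (θ+1)(v')²/v = λv²`:
the quantity `((v')² − (2λ/(2θ−1)) v³)·v^{−2(θ+1)}` is constant along positive
solutions on an interval. -/
theorem stmt_7 (θ lam : ℝ) (hθ : θ ≠ 1 / 2) (I : Set ℝ) (hI : I.OrdConnected)
    (v : ℝ → ℝ) (hv : ContDiffOn ℝ 2 v I) (hvpos : ∀ r ∈ I, 0 < v r)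
    (hode : ∀ r ∈ I,
      -(iteratedDerivWithin 2 v I r) + (θ + 1) * (derivWithin v I r) ^ 2 / v r
        = lam * (v r) ^ 2) :
    ∃ c : ℝ, ∀ r ∈ I,
      ((derivWithin v I r) ^ 2 - 2 * lam / (2 * θ - 1) * (v r) ^ 3)
        * (v r) ^ (-(2 * (θ + 1))) = c := by
  rcases I.subsingleton_or_nontrivial with hsub | hnt
  · rcases hsub.eq_empty_or_singleton with rfl | ⟨a, rfl⟩
    · exact ⟨0, by simp⟩
    · simp
  have hconv : Convex ℝ I := hI.convex
  have hud : UniqueDiffOn ℝ I :=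
    uniqueDiffOn_convex hconv (hconv.nontrivial_iff_nonempty_interior.1 hnt)
  have hdv : DifferentiableOn ℝ v I := hv.differentiableOn (by norm_num)
  have hdp : DifferentiableOn ℝ (derivWithin v I) I :=
    (hv.derivWithin hud (m := 1) (by norm_num)).differentiableOn (by norm_num)
  refine hconv.exists_const_of_hasDerivWithinAt_zero fun r hr =>
    hasDerivWithinAt_firstIntegral hθ (hvpos r hr) (hdv r hr).hasDerivWithinAt
      (hdp r hr).hasDerivWithinAt ?_
  simpa only [iteratedDerivWithin_succ, iteratedDerivWithin_zero] using hode r hr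
end

section
/- Let θ > 1/2 and v₀ > 0. Then (a) for every v ∈ (0, v₀) one has v³ − v₀^{1−2θ}·v^{2(θ+1)} > 0, and (b) the improper integral ∫₀^{v₀} (v³ − v₀^{1−2θ}·v^{2(θ+1)})^{−1/2} dv diverges to +∞, i.e. the function v ↦ (v³ − v₀^{1−2θ}·v^{2(θ+1)})^{−1/2} is not integrable on (0, v₀). -/
/-- For `θ > 1/2` and `v₀ > 0`, the quantity `v³ − v₀^{1−2θ} v^{2(θ+1)}` is positive
on `(0, v₀)` and its inverse square root is not integrable on `(0, v₀)`. -/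
theorem stmt_8 (θ : ℝ) (hθ : 1 / 2 < θ) (v₀ : ℝ) (hv₀ : 0 < v₀) :
    (∀ v ∈ Set.Ioo (0:ℝ) v₀,
      0 < v ^ 3 - v₀ ^ (1 - 2 * θ) * v ^ (2 * (θ + 1))) ∧
    ¬ MeasureTheory.IntegrableOn
        (fun v : ℝ =>
          (Real.sqrt (v ^ 3 - v₀ ^ (1 - 2 * θ) * v ^ (2 * (θ + 1))))⁻¹)
        (Set.Ioo 0 v₀) := by
  have hpos : ∀ v ∈ Set.Ioo (0:ℝ) v₀,
      0 < v ^ 3 - v₀ ^ (1 - 2 * θ) * v ^ (2 * (θ + 1)) := by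
    rintro v ⟨hv, hvv⟩
    have hsplit : v ^ (2 * (θ + 1)) = v ^ 3 * v ^ (2 * θ - 1) := by
      rw [← Real.rpow_natCast v 3, ← Real.rpow_add hv]
      congr 1
      push_cast
      ring
    have hcancel : v₀ ^ (1 - 2 * θ) * v₀ ^ (2 * θ - 1) = 1 := by
      rw [← Real.rpow_add hv₀]
      simp
    have hlt : v ^ (2 * θ - 1) < v₀ ^ (2 * θ - 1) :=
      Real.rpow_lt_rpow hv.le hvv (by linarith)
    have hlt_one : v₀ ^ (1 - 2 * θ) * v ^ (2 * θ - 1) < 1 :=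
      (mul_lt_mul_of_pos_left hlt (Real.rpow_pos_of_pos hv₀ _)).trans_eq hcancel
    rw [hsplit]
    nlinarith [pow_pos hv 3]
  refine ⟨hpos, fun h => ?_⟩
  have hint : MeasureTheory.IntegrableOn (fun v : ℝ => v ^ (-(3 / 2) : ℝ)) (Set.Ioo 0 v₀) := by
    refine MeasureTheory.Integrable.mono' h (by fun_prop) ?_
    filter_upwards [MeasureTheory.ae_restrict_mem measurableSet_Ioo] with v hv
    have hsqrt : v ^ (3 / 2 : ℝ) = Real.sqrt (v ^ 3) := by
      rw [Real.sqrt_eq_rpow, ← Real.rpow_natCast v 3, ← Real.rpow_mul hv.1.le]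
      norm_num
    rw [Real.norm_of_nonneg (Real.rpow_nonneg hv.1.le _), Real.rpow_neg hv.1.le, hsqrt]
    refine inv_anti₀ (Real.sqrt_pos.2 (hpos v hv)) (Real.sqrt_le_sqrt ?_)
    exact sub_le_self _
      (mul_nonneg (Real.rpow_nonneg hv₀.le _) (Real.rpow_nonneg hv.1.le _))
  have := (intervalIntegral.integrableOn_Ioo_rpow_iff hv₀).1 hint
  linarith
end

section
/- For every θ > 1/2 there exist λ > 0 and an infinitely differentiable function u : ℝ → ℝ such that: u''(x) > 0 for all x ∈ ℝ; all odd-order derivatives of u vanish at 0 (u^{(2k−1)}(0) = 0 for every k ≥ 1); u''' is not identically zero, so u is not a quadratic polynomial; and −u''''(x) + (θ+1)(u'''(x))²/u''(x) = λ·(u''(x))² for all x ∈ ℝ. -/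
open Real Set Filter Topology
open scoped ContDiff

/-- A smooth function on the line has a smooth primitive vanishing at the origin. -/
theorem exists_contDiff_primitive {f : ℝ → ℝ} (hf : ContDiff ℝ ∞ f) :
    ∃ F : ℝ → ℝ, ContDiff ℝ ∞ F ∧ F 0 = 0 ∧ ∀ x, HasDerivAt F (f x) x := by
  have hd : ∀ x, HasDerivAt (fun y => ∫ t in (0 : ℝ)..y, f t) (f x) x := fun x =>
    (hf.continuous.integral_hasStrictDerivAt 0 x).hasDerivAt
  refine ⟨fun y => ∫ t in (0 : ℝ)..y, f t, ?_, by simp, hd⟩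
  rw [contDiff_infty_iff_deriv]
  exact ⟨fun x => (hd x).differentiableAt, by rwa [funext fun x => (hd x).deriv]⟩

/-- The primitive of an even function vanishing at the origin is odd. -/
theorem odd_of_hasDerivAt_even {F f : ℝ → ℝ} (hF : ∀ x, HasDerivAt F (f x) x)
    (hf : ∀ x, f (-x) = f x) (h0 : F 0 = 0) (x : ℝ) : F (-x) = -F x := by
  have hd : ∀ y, HasDerivAt (fun z => F (-z) + F z) 0 y := fun y => by
    exact (((hF (-y)).scomp y (hasDerivAt_neg y)).add (hF y)).congr_deriv (by simp [hf])
  have h := is_const_of_deriv_eq_zero (fun y => (hd y).differentiableAt)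
    (fun y => (hd y).deriv) x 0
  simp only [neg_zero, h0, add_zero] at h
  linarith

/-- A primitive of an odd function is even. -/
theorem even_of_hasDerivAt_odd {F f : ℝ → ℝ} (hF : ∀ x, HasDerivAt F (f x) x)
    (hf : ∀ x, f (-x) = -f x) (x : ℝ) : F (-x) = F x := by
  have hd : ∀ y, HasDerivAt (fun z => F (-z) - F z) 0 y := fun y => by
    exact (((hF (-y)).scomp y (hasDerivAt_neg y)).sub (hF y)).congr_deriv (by simp [hf])
  have h := is_const_of_deriv_eq_zero (fun y => (hd y).differentiableAt)
    (fun y => (hd y).deriv) x 0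
  simp only [neg_zero, sub_self] at h
  linarith

theorem contDiff_one_add_sq_rpow (b : ℝ) : ContDiff ℝ ∞ fun t : ℝ => (1 + t ^ 2) ^ b :=
  (contDiff_const.add (contDiff_id.pow 2)).rpow_const_of_ne fun t => by
    simp only [id]; positivity

/-- For `b ≤ 1/2` the equation `s' = (1 + s²)ᵇ` has a global smooth odd solution. -/
theorem exists_odd_solution {b : ℝ} (hb : b ≤ 1 / 2) :
    ∃ s : ℝ → ℝ, ContDiff ℝ ∞ s ∧ (∀ x, s (-x) = -s x) ∧
      ∀ x, HasDerivAt s ((1 + s x ^ 2) ^ b) x := by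
  obtain ⟨G, hG, hG0, hGd⟩ := exists_contDiff_primitive (contDiff_one_add_sq_rpow (-b))
  have hpos : ∀ t : ℝ, 0 < (1 + t ^ 2) ^ (-b) := fun t => by positivity
  have hodd : ∀ x, G (-x) = -G x := odd_of_hasDerivAt_even hGd (fun x => by simp) hG0
  have hmono : StrictMono G := strictMono_of_deriv_pos fun x => by
    rw [(hGd x).deriv]; exact hpos x
  have hcmp : Monotone fun t => G t - arsinh t := by
    have hd : ∀ t, HasDerivAt (fun t => G t - arsinh t)
        ((1 + t ^ 2) ^ (-b) - (√(1 + t ^ 2))⁻¹) t := fun t =>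
      (hGd t).sub (hasDerivAt_arsinh t)
    refine monotone_of_deriv_nonneg (fun t => (hd t).differentiableAt) fun t => ?_
    rw [(hd t).deriv, sub_nonneg, sqrt_eq_rpow, ← rpow_neg (by positivity)]
    exact rpow_le_rpow_of_exponent_le (by nlinarith [sq_nonneg t]) (by linarith)
  have htop : Tendsto G atTop atTop := by
    refine tendsto_atTop_mono' _ ?_ sinhOrderIso.symm.tendsto_atTop
    filter_upwards [eventually_ge_atTop 0] with t ht
    have h := hcmp ht
    simp only [hG0, arsinh_zero, sub_zero] at h
    exact sub_nonneg.1 h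
  have hbot : Tendsto G atBot atBot := by
    have h := tendsto_neg_atTop_atBot.comp (htop.comp tendsto_neg_atBot_atTop)
    refine h.congr fun t => ?_
    simp [hodd]
  have hsurj := hG.continuous.surjective htop hbot
  let e : ℝ ≃ₜ ℝ := (hmono.orderIsoOfSurjective G hsurj).toHomeomorph
  have he : ∀ x, G (e.symm x) = x := e.apply_symm_apply
  refine ⟨e.symm, e.contDiff_symm_deriv (fun x => (hpos x).ne') hGd hG, fun x => ?_, fun x => ?_⟩
  · apply hmono.injective
    rw [hodd, he, he]
  · have h := HasDerivAt.of_local_left_inverse e.symm.continuous.continuousAt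
      (hGd (e.symm x)) (hpos _).ne' (Eventually.of_forall he)
    rwa [← rpow_neg (by positivity), neg_neg] at h

theorem iteratedDeriv_odd_eq_zero_of_even {f : ℝ → ℝ} (hf : ∀ x, f (-x) = f x) {n : ℕ}
    (hn : Odd n) : iteratedDeriv n f 0 = 0 := by
  have h := iteratedDeriv_comp_neg n f 0
  rw [funext hf, hn.neg_one_pow, neg_zero, neg_one_smul] at h
  linarith

/-- For every `θ > 1/2` there is a non-quadratic, smooth, strictly convex entire
solution of the one-dimensional eigenvalue equation
`−u'''' + (θ+1)(u''')²/u'' = λ (u'')²` with some `λ > 0`, all of whose odd-order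
derivatives vanish at the origin. -/
theorem stmt_9 (θ : ℝ) (hθ : 1 / 2 < θ) :
    ∃ lam : ℝ, 0 < lam ∧ ∃ u : ℝ → ℝ,
      ContDiff ℝ (⊤ : ℕ∞) u ∧
      (∀ x : ℝ, 0 < iteratedDeriv 2 u x) ∧
      (∀ k : ℕ, 1 ≤ k → iteratedDeriv (2 * k - 1) u 0 = 0) ∧
      (∃ x : ℝ, iteratedDeriv 3 u x ≠ 0) ∧
      (∀ x : ℝ, -(iteratedDeriv 4 u x)
        + (θ + 1) * (iteratedDeriv 3 u x) ^ 2 / iteratedDeriv 2 u x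
        = lam * (iteratedDeriv 2 u x) ^ 2) := by
  obtain ⟨a, ha, hθa⟩ : ∃ a : ℝ, 0 < a ∧ θ * a = (a + 1) / 2 := by
    have h : 0 < 2 * θ - 1 := by linarith
    exact ⟨(2 * θ - 1)⁻¹, inv_pos.2 h, by
      linear_combination (1 / 2) * mul_inv_cancel₀ h.ne'⟩
  obtain ⟨s, hs, hs_odd, hsd⟩ := exists_odd_solution (b := (1 - a) / 2) (by linarith)
  have hR : ∀ x, 0 < 1 + s x ^ 2 := fun x => by positivity
  have hRd : ∀ c x, HasDerivAt (fun y => (1 + s y ^ 2) ^ c)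
      (2 * c * s x * (1 + s x ^ 2) ^ (c - 1 + (1 - a) / 2)) x := fun c x => by
    refine ((((hsd x).pow 2).const_add 1).rpow_const (p := c)
      (Or.inl (hR x).ne')).congr_deriv ?_
    rw [rpow_add (hR x)]
    simp
    ring
  obtain ⟨p, hp, hp0, hpd⟩ := exists_contDiff_primitive ((contDiff_one_add_sq_rpow (-a)).comp hs)
  obtain ⟨u, hu, -, hud⟩ := exists_contDiff_primitive hp
  have hv_even : ∀ x, ((fun t : ℝ => (1 + t ^ 2) ^ (-a)) ∘ s) (-x)
      = ((fun t : ℝ => (1 + t ^ 2) ^ (-a)) ∘ s) x := fun x => by simp [hs_odd]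
  have hu_even := even_of_hasDerivAt_odd hud (odd_of_hasDerivAt_even hpd hv_even hp0)
  have h1 : iteratedDeriv 1 u = p := by
    rw [iteratedDeriv_one]; exact funext fun x => (hud x).deriv
  have h2 : iteratedDeriv 2 u = fun x => (1 + s x ^ 2) ^ (-a) := by
    rw [iteratedDeriv_succ, h1]; exact funext fun x => (hpd x).deriv
  have h3 : iteratedDeriv 3 u
      = fun x => 2 * (-a) * s x * (1 + s x ^ 2) ^ (-a - 1 + (1 - a) / 2) := by
    rw [iteratedDeriv_succ, h2]; exact funext fun x => (hRd _ x).deriv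
  have h4 : ∀ x, iteratedDeriv 4 u x
      = 2 * (-a) * (1 + s x ^ 2) ^ ((1 - a) / 2) * (1 + s x ^ 2) ^ (-a - 1 + (1 - a) / 2)
        + 2 * (-a) * s x * (2 * (-a - 1 + (1 - a) / 2) * s x
          * (1 + s x ^ 2) ^ (-a - 1 + (1 - a) / 2 - 1 + (1 - a) / 2)) := fun x => by
    rw [iteratedDeriv_succ, h3]
    exact (((hsd x).const_mul _).mul (hRd _ x)).deriv
  refine ⟨2 * a, by positivity, u, hu, fun x => ?_, fun k hk => ?_, ?_, fun x => ?_⟩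
  · rw [h2]; exact rpow_pos_of_pos (hR x) _
  · exact iteratedDeriv_odd_eq_zero_of_even hu_even ⟨k - 1, by omega⟩
  · by_contra! h
    have hs0 : ∀ x, s x = 0 := fun x => by
      have hx := h x
      rw [h3] at hx
      simpa [ha.ne', (rpow_pos_of_pos (hR x) _).ne'] using hx
    have hd := hsd 0
    rw [show s = fun _ => 0 from funext hs0] at hd
    simpa using hd.unique (hasDerivAt_const 0 0)
  · simp only [h4, h3, h2]
    have hr := hR x
    set r := 1 + s x ^ 2 with hr_def
    set P := r ^ (-2 * a - 1) with hP
    have e1 : r ^ ((1 - a) / 2) * r ^ (-a - 1 + (1 - a) / 2) = P * r := by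
      rw [← rpow_add hr, hP, ← rpow_add_one hr.ne']; ring_nf
    have e2 : r ^ (-a - 1 + (1 - a) / 2 - 1 + (1 - a) / 2) = P := by
      rw [hP]; ring_nf
    have e3 : (r ^ (-a - 1 + (1 - a) / 2)) ^ 2 / r ^ (-a) = P := by
      rw [← rpow_natCast, ← rpow_mul hr.le, ← rpow_sub hr, hP]; congr 1; push_cast; ring
    have e4 : (r ^ (-a)) ^ 2 = P * r := by
      rw [← rpow_natCast, ← rpow_mul hr.le, hP, ← rpow_add_one hr.ne']
      congr 1; push_cast; ring
    rw [e2, e4, mul_assoc (2 * -a) (r ^ ((1 - a) / 2)), e1, mul_pow, mul_div_assoc,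
      mul_div_assoc, e3]
    linear_combination (4 * a * s x ^ 2 * P) * hθa
end

section
/- Let η₀ > 1 and let ζ : [1, η₀] → ℝ be continuously differentiable with ζ(1) = 0, ζ'(1) = 2, and ζ(η) > 0 for all η ∈ (1, η₀]. Then for any r₀ ∈ (0,1] and η̄₀ ∈ (1, η₀] there exists a unique continuous function η̄ : [0, r₀] → [1, η₀] with η̄(r₀) = η̄₀, η̄(0) = 1, and η̄'(r) = ζ(η̄(r))/r for all r ∈ (0, r₀]; moreover η̄ is continuously differentiable on [0, r₀] with η̄'(0) = 0, twice continuously differentiable on (0, r₀], and for every α ∈ (0,1) there exists a constant C_α > 0 such that 0 ≤ η̄(r) − 1 ≤ C_α·r^{2α} for all r ∈ [0, r₀]. -/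
open Set Filter Topology

/-- A positive bounded continuous autonomous field on the line has a global solution through every
initial value, and this solution is an increasing bijection. -/
lemma exists_global_solution_of_pos_of_le {w : ℝ → ℝ} (hw : Continuous w) (hpos : ∀ x, 0 < w x)
    {L : ℝ} (hL : ∀ x, w x ≤ L) (x₀ : ℝ) :
    ∃ u : ℝ → ℝ, u 0 = x₀ ∧ StrictMono u ∧ Tendsto u atBot atBot ∧
      ∀ t, HasDerivAt u (w (u t)) t := by
  have hL0 : 0 < L := (hpos 0).trans_le (hL 0)
  set K : ℝ → ℝ := fun x => ∫ y in x₀..x, (w y)⁻¹ with hK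
  have hd : ∀ x, HasDerivAt K (w x)⁻¹ x := fun x =>
    ((hw.inv₀ fun x => (hpos x).ne').integral_hasStrictDerivAt x₀ x).hasDerivAt
  have hmono : StrictMono K :=
    strictMono_of_hasDerivAt_pos hd fun x => inv_pos.2 (hpos x)
  have hsub : Monotone fun x => K x - L⁻¹ * x :=
    monotone_of_hasDerivAt_nonneg
      (fun x => (hd x).sub (by simpa using (hasDerivAt_id x).const_mul L⁻¹))
      fun x => sub_nonneg.2 (inv_anti₀ (hpos x) (hL x))
  have htop : Tendsto K atTop atTop := by
    refine tendsto_atTop_mono' _ ?_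
      (tendsto_atTop_add_const_right atTop (K 0) (tendsto_id.const_mul_atTop (inv_pos.2 hL0)))
    filter_upwards [eventually_ge_atTop 0] with x hx
    have := hsub hx
    simp only [mul_zero, id] at this ⊢
    linarith
  have hbot : Tendsto K atBot atBot := by
    refine tendsto_atBot_mono' _ ?_
      (tendsto_atBot_add_const_right atBot (K 0) (tendsto_id.const_mul_atBot (inv_pos.2 hL0)))
    filter_upwards [eventually_le_atBot 0] with x hx
    have := hsub hx
    simp only [mul_zero, id] at this ⊢
    linarith
  have hcont : Continuous K := continuous_iff_continuousAt.2 fun x => (hd x).continuousAt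
  let e := hmono.orderIsoOfSurjective K (hcont.surjective htop hbot)
  have hKe : ∀ t, K (e.symm t) = t := fun t => e.apply_symm_apply t
  refine ⟨e.symm, hmono.injective ?_, e.symm.strictMono, e.symm.tendsto_atBot, fun t => ?_⟩
  · rw [hKe]; simp [hK]
  · simpa using (hd (e.symm t)).of_local_left_inverse e.symm.continuous.continuousAt
      (inv_pos.2 (hpos _)).ne' (.of_forall hKe)

/-- A monotone function whose derivative is eventually at least `c` at `-∞` lies below a line of
slope `c` on the negative half-line. -/
lemma exists_le_linear_of_le_deriv {u u' : ℝ → ℝ} (hu : Monotone u)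
    (hd : ∀ t, HasDerivAt u (u' t) t) {c : ℝ} (hc : 0 ≤ c) (hev : ∀ᶠ t in atBot, c ≤ u' t) :
    ∃ d, ∀ t ≤ 0, u t ≤ c * t + d := by
  obtain ⟨T, hT⟩ := eventually_atBot.1 hev
  refine ⟨u 0 - c * min T 0, fun t ht => ?_⟩
  rcases le_total t (min T 0) with h | h
  · have hm : MonotoneOn (fun t => u t - c * t) (Iic (min T 0)) := by
      have hd' : ∀ t, HasDerivAt (fun t => u t - c * t) (u' t - c) t := fun t =>
        (hd t).sub (by simpa using (hasDerivAt_id t).const_mul c)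
      refine monotoneOn_of_deriv_nonneg (convex_Iic _)
        (fun t _ => (hd' t).continuousAt.continuousWithinAt)
        (fun t _ => (hd' t).differentiableAt.differentiableWithinAt) fun t ht => ?_
      rw [(hd' t).deriv]
      exact sub_nonneg.2 (hT t ((interior_subset ht).trans (min_le_left _ _)))
    have h1 := hm h self_mem_Iic h
    have h2 := hu (min_le_right T 0)
    simp only at h1
    linarith
  · have h1 := hu ht
    have h2 := mul_le_mul_of_nonneg_left h hc
    linarith

/-- The field obtained from `η' = ζ η` by the change of variables `η = 1 + exp x`, where `ζ` is
extended by a constant to the right of `b`. -/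
noncomputable def logField (ζ : ℝ → ℝ) (b x : ℝ) : ℝ :=
  ζ (min (1 + Real.exp x) b) / Real.exp x

lemma min_one_add_exp_mem_Ioc {b : ℝ} (hb : 1 < b) (x : ℝ) :
    min (1 + Real.exp x) b ∈ Ioc 1 b :=
  ⟨lt_min (by linarith [Real.exp_pos x]) hb, min_le_right _ _⟩

lemma continuous_logField {ζ : ℝ → ℝ} {b : ℝ} (hb : 1 < b) (hζ : ContinuousOn ζ (Icc 1 b)) :
    Continuous (logField ζ b) :=
  (hζ.comp_continuous (by fun_prop)
    fun x => Ioc_subset_Icc_self (min_one_add_exp_mem_Ioc hb x)).div Real.continuous_exp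
      fun x => (Real.exp_pos x).ne'

lemma logField_pos {ζ : ℝ → ℝ} {b : ℝ} (hb : 1 < b) (hpos : ∀ η ∈ Ioc 1 b, 0 < ζ η) (x : ℝ) :
    0 < logField ζ b x :=
  div_pos (hpos _ (min_one_add_exp_mem_Ioc hb x)) (Real.exp_pos x)

lemma logField_le {ζ : ℝ → ℝ} {b L : ℝ} (hb : 1 < b) (hL0 : 0 ≤ L)
    (hL : ∀ η ∈ Icc 1 b, ζ η ≤ L * (η - 1)) (x : ℝ) : logField ζ b x ≤ L := by
  rw [logField, div_le_iff₀ (Real.exp_pos x)]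
  refine (hL _ (Ioc_subset_Icc_self (min_one_add_exp_mem_Ioc hb x))).trans ?_
  gcongr
  linarith [min_le_left (1 + Real.exp x) b]

lemma tendsto_logField_atBot {ζ : ℝ → ℝ} {b c : ℝ} (hb : 1 < b) (hζ1 : ζ 1 = 0)
    (hd : HasDerivWithinAt ζ c (Icc 1 b) 1) : Tendsto (logField ζ b) atBot (𝓝 c) := by
  have hexp : Tendsto (fun x => 1 + Real.exp x) atBot (𝓝 1) := by
    simpa using Real.tendsto_exp_atBot.const_add 1
  have hle : ∀ᶠ x in atBot, 1 + Real.exp x ≤ b :=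
    (hexp.eventually (gt_mem_nhds hb)).mono fun x hx => hx.le
  have hlim : Tendsto (fun x => 1 + Real.exp x) atBot (𝓝[Icc 1 b \ {1}] 1) := by
    refine tendsto_nhdsWithin_iff.2 ⟨hexp, hle.mono fun x hx => ?_⟩
    have := Real.exp_pos x
    exact ⟨⟨by linarith, hx⟩, by simp⟩
  refine ((hasDerivWithinAt_iff_tendsto_slope.1 hd).comp hlim).congr' (hle.mono fun x hx => ?_)
  simp [logField, slope_def_field, hζ1, min_eq_left hx]

/-- The radial profile attached to a solution `u` in logarithmic variables. -/
noncomputable def radialProfile (u : ℝ → ℝ) (R r : ℝ) : ℝ :=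
  if r ≤ 0 then 1 else 1 + Real.exp (u (Real.log (r / R)))

section RadialProfile

variable {u : ℝ → ℝ} {R r : ℝ}

lemma radialProfile_of_nonpos (hr : r ≤ 0) : radialProfile u R r = 1 := if_pos hr

lemma radialProfile_of_pos (hr : 0 < r) :
    radialProfile u R r = 1 + Real.exp (u (Real.log (r / R))) := if_neg hr.not_ge

lemma one_le_radialProfile (u : ℝ → ℝ) (R r : ℝ) : 1 ≤ radialProfile u R r := by
  unfold radialProfile
  split_ifs
  · rfl
  · linarith [Real.exp_pos (u (Real.log (r / R)))]

lemma radialProfile_sub_one_le {c d : ℝ} (hu : ∀ t ≤ 0, u t ≤ c * t + d) (hR : 0 < R)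
    (hr : r ∈ Ioc 0 R) : radialProfile u R r - 1 ≤ Real.exp d * (r / R) ^ c := by
  have hrR : 0 < r / R := div_pos hr.1 hR
  rw [radialProfile_of_pos hr.1, Real.rpow_def_of_pos hrR, ← Real.exp_add, add_sub_cancel_left]
  refine Real.exp_le_exp.2 ((hu _ (Real.log_nonpos hrR.le ((div_le_one hR).2 hr.2))).trans ?_)
  linarith

lemma hasDerivAt_radialProfile {ζ : ℝ → ℝ} {b : ℝ} (hu : ∀ t, HasDerivAt u (logField ζ b (u t)) t)
    (hR : 0 < R) (hr : 0 < r) :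
    HasDerivAt (radialProfile u R) (ζ (min (radialProfile u R r) b) / r) r := by
  have hlog : HasDerivAt (fun r => Real.log (r / R)) (1 / R / (r / R)) r :=
    ((hasDerivAt_id r).div_const R).log (div_pos hr hR).ne'
  have h := (((hu (Real.log (r / R))).comp r hlog).exp).const_add 1
  refine (h.congr_of_eventuallyEq ?_).congr_deriv ?_
  · filter_upwards [lt_mem_nhds hr] with s hs using radialProfile_of_pos hs
  · rw [radialProfile_of_pos hr, logField]
    have := (Real.exp_pos (u (Real.log (r / R)))).ne'
    simp only [Function.comp_apply]
    field_simp

end RadialProfile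

/-- Two functions on `[0, R]` that solve `f' = ζ f / r` on `(0, R]` with values in a set where `ζ`
is Lipschitz and that agree at `R` agree on `(0, R]`. -/
lemma eqOn_Ioc_of_hasDerivWithinAt_div {ζ f g : ℝ → ℝ} {s : Set ℝ} {K : NNReal} {R : ℝ}
    (hζ : LipschitzOnWith K ζ s)
    (hf : ∀ r ∈ Ioc 0 R, HasDerivWithinAt f (ζ (f r) / r) (Icc 0 R) r)
    (hfs : MapsTo f (Icc 0 R) s)
    (hg : ∀ r ∈ Ioc 0 R, HasDerivWithinAt g (ζ (g r) / r) (Icc 0 R) r)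
    (hgs : MapsTo g (Icc 0 R) s) (hR : f R = g R) : EqOn f g (Ioc 0 R) := by
  intro a ha
  have hsub : Icc a R ⊆ Icc 0 R := Icc_subset_Icc_left ha.1.le
  have hpos : ∀ t ∈ Icc a R, t ∈ Ioc 0 R := fun t ht => ⟨ha.1.trans_le ht.1, ht.2⟩
  have hnhds : ∀ t ∈ Ioc a R, Icc 0 R ∈ 𝓝[Iic t] t := fun t ht =>
    mem_of_superset (Ioc_mem_nhdsLE (ha.1.trans ht.1)) fun x hx => ⟨hx.1.le, hx.2.trans ht.2⟩
  have hlip : ∀ t ∈ Ioc a R, LipschitzOnWith (K / a.toNNReal) (fun x => ζ x / t) s := by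
    intro t ht
    have ht0 : 0 < t := ha.1.trans ht.1
    refine LipschitzOnWith.of_dist_le_mul fun x hx y hy => ?_
    rw [Real.dist_eq, ← sub_div, abs_div, abs_of_pos ht0, NNReal.coe_div,
      Real.coe_toNNReal _ ha.1.le, div_mul_eq_mul_div]
    exact div_le_div₀ (by positivity) (hζ.dist_le_mul x hx y hy) ha.1 ht.1.le
  exact ODE_solution_unique_of_mem_Icc_left (v := fun t x => ζ x / t) (s := fun _ => s) hlip
    (fun t ht => ((hf t (hpos t ht)).mono hsub).continuousWithinAt)
    (fun t ht => (hf t (hpos t (Ioc_subset_Icc_self ht))).mono_of_mem_nhdsWithin (hnhds t ht))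
    (fun t ht => hfs (hsub (Ioc_subset_Icc_self ht)))
    (fun t ht => ((hg t (hpos t ht)).mono hsub).continuousWithinAt)
    (fun t ht => (hg t (hpos t (Ioc_subset_Icc_self ht))).mono_of_mem_nhdsWithin (hnhds t ht))
    (fun t ht => hgs (hsub (Ioc_subset_Icc_self ht))) hR (left_mem_Icc.2 ha.2)

/-- A superlinear contact estimate `0 ≤ f r - 1 ≤ C r ^ p`, `p > 1`, forces `(f r - 1) / r → 0`. -/
lemma tendsto_sub_one_div_of_le_rpow {f : ℝ → ℝ} {R C p : ℝ} (hp : 1 < p)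
    (h0 : ∀ r, 1 ≤ f r) (h : ∀ r ∈ Ioc 0 R, f r - 1 ≤ C * r ^ p) :
    Tendsto (fun r => (f r - 1) / r) (𝓝[Ioc 0 R] 0) (𝓝 0) := by
  have hlim : Tendsto (fun r : ℝ => C * r ^ (p - 1)) (𝓝[Ioc 0 R] 0) (𝓝 0) := by
    have : ContinuousAt (fun r : ℝ => C * r ^ (p - 1)) 0 :=
      (Real.continuousAt_rpow_const 0 (p - 1) (.inr (by linarith))).const_mul C
    simpa [ContinuousAt, Real.zero_rpow (sub_pos.2 hp).ne'] using
      this.tendsto.mono_left nhdsWithin_le_nhds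
  refine squeeze_zero' ?_ ?_ hlim <;> filter_upwards [self_mem_nhdsWithin] with r hr
  · exact div_nonneg (sub_nonneg.2 (h0 r)) hr.1.le
  · rw [div_le_iff₀ hr.1, mul_assoc, ← Real.rpow_add_one hr.1.ne', sub_add_cancel]
    exact h r hr


/-- Existence, uniqueness, regularity and contact estimate for the singular ODE
`η̄' = ζ(η̄)/r`, `η̄(0) = 1`, `η̄(r₀) = η̄₀`, where `ζ` is `C¹` with `ζ(1)=0`,
`ζ'(1)=2`, `ζ > 0` on `(1, η₀]`. -/
theorem stmt_10 (η₀ : ℝ) (hη₀ : 1 < η₀) (ζ : ℝ → ℝ)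
    (hζ : ContDiffOn ℝ 1 ζ (Set.Icc 1 η₀))
    (hζ1 : ζ 1 = 0) (hζ'1 : derivWithin ζ (Set.Icc 1 η₀) 1 = 2)
    (hζpos : ∀ η ∈ Set.Ioc (1:ℝ) η₀, 0 < ζ η)
    (r₀ : ℝ) (hr₀ : r₀ ∈ Set.Ioc (0:ℝ) 1)
    (e₀ : ℝ) (he₀ : e₀ ∈ Set.Ioc 1 η₀) :
    ∃ ebar : ℝ → ℝ,
      (ContinuousOn ebar (Set.Icc 0 r₀) ∧
        Set.MapsTo ebar (Set.Icc 0 r₀) (Set.Icc 1 η₀) ∧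
        ebar r₀ = e₀ ∧ ebar 0 = 1 ∧
        (∀ r ∈ Set.Ioc (0:ℝ) r₀,
          HasDerivWithinAt ebar (ζ (ebar r) / r) (Set.Icc 0 r₀) r)) ∧
      (∀ g : ℝ → ℝ,
        ContinuousOn g (Set.Icc 0 r₀) →
        Set.MapsTo g (Set.Icc 0 r₀) (Set.Icc 1 η₀) →
        g r₀ = e₀ → g 0 = 1 →
        (∀ r ∈ Set.Ioc (0:ℝ) r₀,
          HasDerivWithinAt g (ζ (g r) / r) (Set.Icc 0 r₀) r) →
        ∀ r ∈ Set.Icc (0:ℝ) r₀, g r = ebar r) ∧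
      ContDiffOn ℝ 1 ebar (Set.Icc 0 r₀) ∧
      derivWithin ebar (Set.Icc 0 r₀) 0 = 0 ∧
      ContDiffOn ℝ 2 ebar (Set.Ioc 0 r₀) ∧
      (∀ α ∈ Set.Ioo (0:ℝ) 1, ∃ C > (0:ℝ), ∀ r ∈ Set.Icc (0:ℝ) r₀,
        0 ≤ ebar r - 1 ∧ ebar r - 1 ≤ C * r ^ (2 * α)) := by
  
  obtain ⟨hr0, -⟩ := hr₀
  obtain ⟨K, hK⟩ := hζ.exists_lipschitzOnWith one_ne_zero (convex_Icc 1 η₀) isCompact_Icc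
  have hζd : HasDerivWithinAt ζ 2 (Icc 1 η₀) 1 :=
    hζ'1 ▸ (hζ.differentiableOn one_ne_zero 1 (left_mem_Icc.2 hη₀.le)).hasDerivWithinAt
  have hζle : ∀ η ∈ Icc 1 η₀, ζ η ≤ K * (η - 1) := fun η hη => by
    have := hK.dist_le_mul η hη 1 (left_mem_Icc.2 hη₀.le)
    rw [Real.dist_eq, Real.dist_eq, hζ1, sub_zero, abs_of_nonneg (sub_nonneg.2 hη.1)] at this
    exact (le_abs_self _).trans this
  have hζnn : ∀ η ∈ Icc 1 η₀, 0 ≤ ζ η := fun η hη => by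
    rcases hη.1.eq_or_lt with rfl | h
    exacts [hζ1.ge, (hζpos η ⟨h, hη.2⟩).le]
  obtain ⟨u, hu0, humono, hubot, hu⟩ := exists_global_solution_of_pos_of_le
    (continuous_logField hη₀ hζ.continuousOn) (logField_pos hη₀ hζpos)
    (logField_le hη₀ K.2 hζle) (Real.log (e₀ - 1))
  set f := radialProfile u r₀ with hf
  have hf0 : f 0 = 1 := radialProfile_of_nonpos le_rfl
  have hf1 : ∀ r, 1 ≤ f r := one_le_radialProfile u r₀
  have hfr₀ : f r₀ = e₀ := by
    rw [hf, radialProfile_of_pos hr0, div_self hr0.ne', Real.log_one, hu0,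
      Real.exp_log (sub_pos.2 he₀.1), add_sub_cancel]
  have hmaps : MapsTo f (Icc 0 r₀) (Icc 1 η₀) := by
    refine fun r hr => ⟨hf1 r, ?_⟩
    rcases hr.1.eq_or_lt with rfl | hr1
    · exact hf0.trans_le hη₀.le
    · refine le_trans ?_ (hfr₀.trans_le he₀.2)
      rw [hf, radialProfile_of_pos hr1, radialProfile_of_pos hr0]
      gcongr
      exact humono.monotone (Real.log_le_log (div_pos hr1 hr0) (by gcongr; exact hr.2))
  have hderiv : ∀ r ∈ Ioc 0 r₀, HasDerivAt f (ζ (f r) / r) r := fun r hr => by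
    have := hasDerivAt_radialProfile hu hr0 hr.1
    rwa [min_eq_left (hmaps (Ioc_subset_Icc_self hr)).2] at this
  have hcontact : ∀ α ∈ Ioo (0 : ℝ) 1, ∃ C > (0 : ℝ), ∀ r ∈ Ioc (0 : ℝ) r₀,
      f r - 1 ≤ C * r ^ (2 * α) := by
    intro α hα
    have hev : ∀ᶠ t in atBot, 2 * α ≤ logField ζ η₀ (u t) :=
      (((tendsto_logField_atBot hη₀ hζ1 hζd).comp hubot).eventually
        (lt_mem_nhds (by linarith [hα.2]))).mono fun t ht => ht.le
    obtain ⟨d, hd⟩ := exists_le_linear_of_le_deriv humono.monotone hu (by linarith [hα.1]) hev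
    refine ⟨Real.exp d / r₀ ^ (2 * α), by positivity, fun r hr => ?_⟩
    refine (radialProfile_sub_one_le hd hr0 hr).trans_eq ?_
    rw [Real.div_rpow hr.1.le hr0.le]
    ring
  have hlim : Tendsto (fun r => (f r - 1) / r) (𝓝[Ioc 0 r₀] 0) (𝓝 0) := by
    obtain ⟨C, -, hC⟩ := hcontact (3 / 4) ⟨by norm_num, by norm_num⟩
    exact tendsto_sub_one_div_of_le_rpow (by norm_num) hf1 hC
  have hIcc : Icc 0 r₀ \ {0} = Ioc 0 r₀ := Icc_sdiff_left
  have hderivIcc : ∀ r ∈ Icc 0 r₀, HasDerivWithinAt f (ζ (f r) / r) (Icc 0 r₀) r := by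
    intro r hr
    rcases hr.1.eq_or_lt with rfl | hr1
    · rw [hasDerivWithinAt_iff_tendsto_slope, hIcc, div_zero]
      refine hlim.congr fun r => ?_
      rw [slope_def_field, hf0, sub_zero]
    · exact (hderiv r ⟨hr1, hr.2⟩).hasDerivWithinAt
  have hcont : ContinuousOn f (Icc 0 r₀) := fun r hr => (hderivIcc r hr).continuousWithinAt
  have hcont' : ContinuousOn (fun r => ζ (f r) / r) (Icc 0 r₀) := by
    intro r hr
    rcases hr.1.eq_or_lt with rfl | hr1
    · rw [← continuousWithinAt_sdiff_self, hIcc, ContinuousWithinAt, div_zero]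
      refine squeeze_zero' ?_ ?_ (by simpa using hlim.const_mul (K : ℝ)) <;>
        filter_upwards [self_mem_nhdsWithin] with r hr
      · exact div_nonneg (hζnn _ (hmaps (Ioc_subset_Icc_self hr))) hr.1.le
      · rw [← mul_div_assoc]
        exact div_le_div_of_nonneg_right (hζle _ (hmaps (Ioc_subset_Icc_self hr))) hr.1.le
    · exact ((hζ.continuousOn.comp hcont hmaps) r hr).div continuousWithinAt_id hr1.ne'
  have huniq : UniqueDiffOn ℝ (Icc 0 r₀) := uniqueDiffOn_Icc hr0
  have hC1 : ContDiffOn ℝ 1 f (Icc 0 r₀) := by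
    rw [show (1 : WithTop ℕ∞) = 0 + 1 from rfl, contDiffOn_succ_iff_derivWithin huniq]
    refine ⟨fun r hr => (hderivIcc r hr).differentiableWithinAt, by simp, ?_⟩
    rw [contDiffOn_zero]
    exact hcont'.congr fun r hr => (hderivIcc r hr).derivWithin (huniq r hr)
  have hC2 : ContDiffOn ℝ 2 f (Ioc 0 r₀) := by
    have huniq' : UniqueDiffOn ℝ (Ioc 0 r₀) := uniqueDiffOn_Ioc 0 r₀
    rw [show (2 : WithTop ℕ∞) = 1 + 1 from one_add_one_eq_two.symm,
      contDiffOn_succ_iff_derivWithin huniq']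
    refine ⟨fun r hr => (hderiv r hr).differentiableAt.differentiableWithinAt, by simp, ?_⟩
    refine ContDiffOn.congr ?_ fun r hr =>
      (hderiv r hr).hasDerivWithinAt.derivWithin (huniq' r hr)
    exact (hζ.comp (hC1.mono Ioc_subset_Icc_self) (hmaps.mono_left Ioc_subset_Icc_self)).div
      contDiffOn_id fun r hr => hr.1.ne'
  refine ⟨f, ⟨hcont, hmaps, hfr₀, hf0, fun r hr => hderivIcc r (Ioc_subset_Icc_self hr)⟩,
    ?_, hC1, ?_, hC2, ?_⟩
  · intro g _ hgm hgr₀ hg0 hgd r hr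
    rcases hr.1.eq_or_lt with rfl | hr1
    · rw [hg0, hf0]
    · exact eqOn_Ioc_of_hasDerivWithinAt_div hK hgd hgm
        (fun r hr => hderivIcc r (Ioc_subset_Icc_self hr)) hmaps (hgr₀.trans hfr₀.symm)
        ⟨hr1, hr.2⟩
  · have h0 : (0 : ℝ) ∈ Icc 0 r₀ := left_mem_Icc.2 hr0.le
    rw [(hderivIcc 0 h0).derivWithin (huniq 0 h0), div_zero]
  · intro α hα
    obtain ⟨C, hC0, hC⟩ := hcontact α hα
    refine ⟨C, hC0, fun r hr => ⟨sub_nonneg.2 (hf1 r), ?_⟩⟩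
    rcases hr.1.eq_or_lt with rfl | hr1
    · rw [hf0, sub_self]
      positivity
    · exact hC r ⟨hr1, hr.2⟩
end

section
/- Let η₀ > 1 and let ζ : [1, η₀] → ℝ be continuously differentiable with ζ(1) = 0, ζ'(1) = 2, ζ(η) > 0 for all η ∈ (1, η₀], and with ζ' monotone non-decreasing on [1, η₀]. Let η̄ : [0, r₀] → [1, η₀] be the solution of η̄'(r) = ζ(η̄(r))/r for r ∈ (0, r₀] with η̄(0) = 1. Then η̄ is twice continuously differentiable on the closed interval [0, r₀], η̄'(0) = 0, and there exists a constant C > 0 such that 0 ≤ η̄(r) − 1 ≤ C·r² for all r ∈ [0, r₀]. -/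
open Set Filter Topology

/-- A `C¹` function on `[a, b]` with non-decreasing derivative lies above its tangent at `a`. -/
theorem tangent_left_le_of_monotoneOn_derivWithin {a b : ℝ} {f : ℝ → ℝ}
    (hf : ContDiffOn ℝ 1 f (Icc a b))
    (hmono : MonotoneOn (derivWithin f (Icc a b)) (Icc a b)) {x : ℝ} (hx : x ∈ Icc a b) :
    derivWithin f (Icc a b) a * (x - a) ≤ f x - f a := by
  have ha : a ∈ Icc a b := ⟨le_rfl, hx.1.trans hx.2⟩
  have hint : ∀ y ∈ interior (Icc a b), Icc a b ∈ 𝓝 y := fun y hy => mem_interior_iff_mem_nhds.1 hy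
  refine (convex_Icc a b).mul_sub_le_image_sub_of_le_deriv hf.continuousOn
    ((hf.differentiableOn one_ne_zero).mono interior_subset) ?_ a ha x hx hx.1
  intro y hy
  rw [← derivWithin_of_mem_nhds (hint y hy)]
  exact hmono ha (interior_subset hy) (interior_subset hy).1

/-- A function on `[a, b]` with continuous second derivative is `C²`. -/
theorem contDiffOn_two_of_hasDerivWithinAt {a b : ℝ} (hab : a < b) {f g h : ℝ → ℝ}
    (hf : ∀ x ∈ Icc a b, HasDerivWithinAt f (g x) (Icc a b) x)
    (hg : ∀ x ∈ Icc a b, HasDerivWithinAt g (h x) (Icc a b) x)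
    (hh : ContinuousOn h (Icc a b)) : ContDiffOn ℝ 2 f (Icc a b) := by
  have hu := uniqueDiffOn_Icc hab
  have hg1 : ContDiffOn ℝ 1 g (Icc a b) := by
    rw [contDiffOn_one_iff_derivWithin hu]
    exact ⟨fun x hx => (hg x hx).differentiableWithinAt,
      hh.congr fun x hx => (hg x hx).derivWithin (hu x hx)⟩
  rw [show (2 : WithTop ℕ∞) = 1 + 1 by norm_num, contDiffOn_succ_iff_derivWithin hu]
  exact ⟨fun x hx => (hf x hx).differentiableWithinAt, by simp,
    hg1.congr fun x hx => (hf x hx).derivWithin (hu x hx)⟩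

/-- With the additional convexity assumption that `ζ'` is monotone non-decreasing,
the solution of the singular ODE `η̄' = ζ(η̄)/r`, `η̄(0)=1`, is `C²` up to `r = 0`,
has `η̄'(0) = 0`, and satisfies the quadratic contact estimate `0 ≤ η̄ − 1 ≤ C r²`. -/
theorem stmt_11 (η₀ : ℝ) (hη₀ : 1 < η₀) (ζ : ℝ → ℝ)
    (hζ : ContDiffOn ℝ 1 ζ (Set.Icc 1 η₀))
    (hζ1 : ζ 1 = 0) (hζ'1 : derivWithin ζ (Set.Icc 1 η₀) 1 = 2)
    (hζpos : ∀ η ∈ Set.Ioc (1:ℝ) η₀, 0 < ζ η)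
    (hζ'mono : MonotoneOn (derivWithin ζ (Set.Icc 1 η₀)) (Set.Icc 1 η₀))
    (r₀ : ℝ) (hr₀ : 0 < r₀)
    (ebar : ℝ → ℝ)
    (hcont : ContinuousOn ebar (Set.Icc 0 r₀))
    (hmaps : Set.MapsTo ebar (Set.Icc 0 r₀) (Set.Icc 1 η₀))
    (h0 : ebar 0 = 1)
    (hode : ∀ r ∈ Set.Ioc (0:ℝ) r₀,
      HasDerivWithinAt ebar (ζ (ebar r) / r) (Set.Icc 0 r₀) r) :
    ContDiffOn ℝ 2 ebar (Set.Icc 0 r₀) ∧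
    derivWithin ebar (Set.Icc 0 r₀) 0 = 0 ∧
    ∃ C > (0:ℝ), ∀ r ∈ Set.Icc (0:ℝ) r₀,
      0 ≤ ebar r - 1 ∧ ebar r - 1 ≤ C * r ^ 2 := by
  have m0 : (0:ℝ) ∈ Icc 0 r₀ := ⟨le_rfl, hr₀.le⟩
  have m1 : (1:ℝ) ∈ Icc 1 η₀ := ⟨le_rfl, hη₀.le⟩
  have hsub : Ioc 0 r₀ ⊆ Icc 0 r₀ := Ioc_subset_Icc_self
  have hζd : ∀ s ∈ Icc 1 η₀, HasDerivWithinAt ζ (derivWithin ζ (Icc 1 η₀) s) (Icc 1 η₀) s :=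
    fun s hs => (hζ.differentiableOn one_ne_zero s hs).hasDerivWithinAt
  have htan : ∀ s ∈ Icc 1 η₀, 2 * (s - 1) ≤ ζ s := fun s hs => by
    simpa [hζ1, hζ'1] using tangent_left_le_of_monotoneOn_derivWithin hζ hζ'mono hs
  -- The quotient `(η̄ - 1) / r²` is non-decreasing.
  have hF : MonotoneOn (fun r => (ebar r - 1) / r ^ 2) (Ioc 0 r₀) := by
    have hd : ∀ r ∈ interior (Ioc 0 r₀), HasDerivAt (fun r => (ebar r - 1) / r ^ 2)
        ((ζ (ebar r) / r * r ^ 2 - (ebar r - 1) * (2 * r)) / (r ^ 2) ^ 2) r := by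
      intro r hr
      rw [interior_Ioc] at hr
      have h1 := ((hode r (Ioo_subset_Ioc_self hr)).hasDerivAt (Icc_mem_nhds hr.1 hr.2)).sub_const 1
      have h2 : HasDerivAt (fun r : ℝ => r ^ 2) (2 * r) r := by simpa using hasDerivAt_pow 2 r
      exact h1.div h2 (pow_ne_zero 2 hr.1.ne')
    refine monotoneOn_of_deriv_nonneg (convex_Ioc _ _) ?_
      (fun r hr => (hd r hr).differentiableAt.differentiableWithinAt) ?_
    · exact ((hcont.mono hsub).sub continuousOn_const).div (by fun_prop)
        fun r hr => pow_ne_zero 2 hr.1.ne'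
    · intro r hr
      rw [(hd r hr).deriv]
      rw [interior_Ioc] at hr
      have hr0 := hr.1
      have := htan _ (hmaps (Ioo_subset_Icc_self hr))
      have e : ζ (ebar r) / r * r ^ 2 - (ebar r - 1) * (2 * r)
          = r * (ζ (ebar r) - 2 * (ebar r - 1)) := by field_simp
      rw [e]
      exact div_nonneg (mul_nonneg hr0.le (by linarith)) (by positivity)
  have hnn : ∀ r ∈ Icc 0 r₀, 0 ≤ ebar r - 1 := fun r hr => sub_nonneg.2 (hmaps hr).1
  obtain ⟨C, hC, hquad⟩ : ∃ C > (0:ℝ), ∀ r ∈ Icc (0:ℝ) r₀, ebar r - 1 ≤ C * r ^ 2 := by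
    refine ⟨(ebar r₀ - 1) / r₀ ^ 2 + 1, ?_, fun r hr => ?_⟩
    · have := hnn r₀ ⟨hr₀.le, le_rfl⟩
      positivity
    · rcases hr.1.eq_or_lt with rfl | hpos
      · simp [h0]
      · have h := hF ⟨hpos, hr.2⟩ ⟨hr₀, le_rfl⟩ hr.2
        simp only at h
        exact (div_le_iff₀ (by positivity)).1 (by linarith)
  obtain ⟨L, hL⟩ : ∃ L, Tendsto (fun r => (ebar r - 1) / r ^ 2) (𝓝[>] 0) (𝓝 L) := by
    refine ⟨_, MonotoneOn.tendsto_nhdsWithin_Ioo_right (nonempty_Ioo.2 hr₀)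
      (hF.mono Ioo_subset_Ioc_self) ⟨0, ?_⟩⟩
    rintro _ ⟨r, hr, rfl⟩
    exact div_nonneg (hnn r (Ioo_subset_Icc_self hr)) (by positivity)
  have hIoc : Ioc 0 r₀ ∈ 𝓝[>] (0:ℝ) := Ioc_mem_nhdsGT hr₀
  have hle : 𝓝[>] (0:ℝ) ≤ 𝓝[Icc 0 r₀] 0 :=
    nhdsWithin_le_iff.2 (mem_of_superset hIoc hsub)
  have hebar : Tendsto ebar (𝓝[Icc 0 r₀] 0) (𝓝[Icc 1 η₀] 1) := by
    have := (hcont 0 m0).tendsto_nhdsWithin hmaps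
    rwa [h0] at this
  have hZ : Tendsto (fun r => ζ (ebar r) / r ^ 2) (𝓝[>] 0) (𝓝 (2 * L)) := by
    have h1 := hζd 1 m1
    rw [hζ'1, hasDerivWithinAt_iff_isLittleO] at h1
    have h2 := h1.comp_tendsto (hebar.mono_left hle)
    have h3 : (fun r => ebar r - 1) =O[𝓝[>] (0:ℝ)] fun r => r ^ 2 := by
      refine Asymptotics.IsBigO.of_bound C ?_
      filter_upwards [hIoc] with r hr
      rw [Real.norm_of_nonneg (hnn r (hsub hr)), Real.norm_of_nonneg (by positivity)]
      exact hquad r (hsub hr)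
    have h4 := (h2.trans_isBigO h3).tendsto_div_nhds_zero.add (hL.const_mul 2)
    rw [zero_add] at h4
    refine h4.congr fun r => ?_
    simp only [Function.comp_apply, hζ1, smul_eq_mul]
    ring
  have hIcc : insert 0 (Ioc 0 r₀) = Icc 0 r₀ := Ioc_insert_left hr₀.le
  have hle' : 𝓝[Ioc 0 r₀] (0:ℝ) ≤ 𝓝[>] 0 := nhdsWithin_mono _ fun r hr => hr.1
  set h : ℝ → ℝ := fun r => if r = 0 then 2 * L else
    derivWithin ζ (Icc 1 η₀) (ebar r) * (ζ (ebar r) / r ^ 2) - ζ (ebar r) / r ^ 2 with hh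
  have hderiv : ∀ r ∈ Icc 0 r₀, HasDerivWithinAt ebar (ζ (ebar r) / r) (Icc 0 r₀) r := by
    intro r hr
    rcases hr.1.eq_or_lt with rfl | hpos
    · rw [div_zero, hasDerivWithinAt_iff_tendsto_slope, Icc_sdiff_left]
      have ht : Tendsto (fun r : ℝ => r) (𝓝[>] 0) (𝓝 0) := tendsto_id.mono_left inf_le_left
      have := (hL.mul ht).mono_left hle'
      rw [mul_zero] at this
      refine this.congr' ?_
      filter_upwards [self_mem_nhdsWithin] with r hr
      have := hr.1.ne'
      rw [slope_def_field, h0]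
      field_simp
      simp
    · exact hode r ⟨hpos, hr.2⟩
  have hderiv2 : ∀ r ∈ Icc 0 r₀,
      HasDerivWithinAt (fun r => ζ (ebar r) / r) (h r) (Icc 0 r₀) r := by
    intro r hr
    rcases hr.1.eq_or_lt with rfl | hpos
    · rw [hasDerivWithinAt_iff_tendsto_slope, Icc_sdiff_left]
      simp only [hh, if_true]
      refine (hZ.mono_left hle').congr fun r => ?_
      rw [slope_def_field, div_zero, sub_zero, sub_zero, div_div, sq]
    · have h1 := (hζd _ (hmaps hr)).comp r (hderiv r hr) hmaps
      have h2 := h1.div (hasDerivWithinAt_id r _) hpos.ne'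
      refine h2.congr_deriv ?_
      simp only [hh, if_neg hpos.ne', Function.comp_apply, id]
      field_simp
  have hhc : ContinuousOn h (Icc 0 r₀) := by
    have hZc := hζ.continuousOn_derivWithin (uniqueDiffOn_Icc hη₀) le_rfl
    intro r hr
    rcases hr.1.eq_or_lt with rfl | hpos
    · rw [← hIcc, continuousWithinAt_insert_self]
      have h1 : Tendsto (fun r => derivWithin ζ (Icc 1 η₀) (ebar r)) (𝓝[>] 0) (𝓝 2) := by
        have := (hZc 1 m1).tendsto.comp (hebar.mono_left hle)
        rwa [hζ'1] at this
      have h2 := ((h1.mul hZ).sub hZ).mono_left hle'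
      have h3 : h 0 = 2 * (2 * L) - 2 * L := by simp only [hh, if_true]; ring
      rw [ContinuousWithinAt, h3]
      refine h2.congr' ?_
      filter_upwards [self_mem_nhdsWithin] with r hr
      simp only [hh, if_neg hr.1.ne']
    · have h1 : ContinuousWithinAt (fun r => ζ (ebar r) / r ^ 2) (Icc 0 r₀) r :=
        ((hζ.continuousOn.comp hcont hmaps) r hr).div (by fun_prop) (pow_ne_zero 2 hpos.ne')
      have h2 := (((hZc.comp hcont hmaps) r hr).mul h1).sub h1
      refine h2.congr_of_eventuallyEq ?_ (by simp [hh, hpos.ne'])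
      filter_upwards [mem_nhdsWithin_of_mem_nhds (Ioi_mem_nhds hpos)] with x hx
      simp [hh, (mem_Ioi.1 hx).ne']
  refine ⟨contDiffOn_two_of_hasDerivWithinAt hr₀ hderiv hderiv2 hhc, ?_,
    C, hC, fun r hr => ⟨hnn r hr, hquad r hr⟩⟩
  simpa using (hderiv 0 m0).derivWithin (uniqueDiffOn_Icc hr₀ 0 m0)
end

section
/- Let η̄ : [0,1] → ℝ be twice continuously differentiable with η̄(0) = 1 and η̄'(0) = 0, and let v₀ > 0, r₀ ∈ (0,1]. Define v : [0,1] → ℝ by v(0) = 0 and v(r) = v₀·exp(∫_{r₀}^{r} η̄(s)/s ds) for r ∈ (0,1]. Then v is twice continuously differentiable on [0,1] and satisfies v(0) = 0, v'(0) > 0, and v''(0) = 0. -/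
open Set in
/-- If `e` is `1` at `0` with vanishing one-sided derivative there, then `s ↦ (e s - 1) / s`
(with value `0` at `0`) is continuous on `[0,1]`. -/
theorem continuousOn_sub_one_div_self {e : ℝ → ℝ} (hc : ContinuousOn e (Icc 0 1))
    (h0 : e 0 = 1) (hd : HasDerivWithinAt e 0 (Icc 0 1) 0) :
    ContinuousOn (fun s => (e s - 1) / s) (Icc 0 1) := by
  intro x hx
  rcases eq_or_ne x 0 with rfl | hx0
  · rw [hasDerivWithinAt_iff_tendsto_slope] at hd
    rw [← continuousWithinAt_sdiff_self]
    have : (fun s => (e s - 1) / s) = slope e 0 := by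
      ext s
      rw [slope_def_field, h0, sub_zero]
    rw [this]
    simpa [ContinuousWithinAt] using hd
  · exact ((hc x hx).sub continuousWithinAt_const).div continuousWithinAt_id hx0

open Set in
/-- For `r₀, r > 0` the factor `exp (∫ e(s)/s)` splits off the linear factor `r / r₀`. -/
theorem exp_integral_div_self {e p : ℝ → ℝ} {r₀ r : ℝ} (hp : Continuous p)
    (hpe : ∀ s ∈ Icc (0 : ℝ) 1, s * p s = e s - 1)
    (hr₀ : r₀ ∈ Ioc (0 : ℝ) 1) (hr : r ∈ Ioc (0 : ℝ) 1) :
    Real.exp (∫ s in r₀..r, e s / s) = Real.exp (∫ s in r₀..r, p s) * (r / r₀) := by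
  have hsub : uIcc r₀ r ⊆ Ioc 0 1 := ordConnected_Ioc.uIcc_subset hr₀ hr
  have h0 : (0 : ℝ) ∉ uIcc r₀ r := fun h => lt_irrefl _ (hsub h).1
  have h1 : ∫ s in r₀..r, e s / s = ∫ s in r₀..r, (p s + 1 / s) := by
    refine intervalIntegral.integral_congr fun s hs => ?_
    have hs' := hsub hs
    have hs0 : s ≠ 0 := hs'.1.ne'
    have := hpe s (Ioc_subset_Icc_self hs')
    field_simp
    linarith
  rw [h1, intervalIntegral.integral_add (hp.intervalIntegrable _ _)
    (intervalIntegral.intervalIntegrable_one_div (fun s hs h => h0 (h ▸ hs))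
      continuousOn_id),
    integral_one_div h0, Real.exp_add, Real.exp_log (div_pos hr.1 hr₀.1)]

/-- If `η̄` is `C²` on `[0,1]` with `η̄(0) = 1` and `η̄'(0) = 0`, then the recovered
radial derivative `v(r) = v₀ exp(∫_{r₀}^r η̄(s)/s ds)` (with `v(0) = 0`) is `C²` on
`[0,1]` with `v(0) = 0`, `v'(0) > 0` and `v''(0) = 0`. -/
theorem stmt_12 (ebar : ℝ → ℝ)
    (hC2 : ContDiffOn ℝ 2 ebar (Set.Icc 0 1))
    (h0 : ebar 0 = 1)
    (h'0 : derivWithin ebar (Set.Icc 0 1) 0 = 0)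
    (v₀ r₀ : ℝ) (hv₀ : 0 < v₀) (hr₀ : r₀ ∈ Set.Ioc (0:ℝ) 1)
    (v : ℝ → ℝ) (hv0 : v 0 = 0)
    (hv : ∀ r ∈ Set.Ioc (0:ℝ) 1,
      v r = v₀ * Real.exp (∫ s in r₀..r, ebar s / s)) :
    ContDiffOn ℝ 2 v (Set.Icc 0 1) ∧ v 0 = 0 ∧
    0 < derivWithin v (Set.Icc 0 1) 0 ∧
    iteratedDerivWithin 2 v (Set.Icc 0 1) 0 = 0 := by
  have hU : UniqueDiffOn ℝ (Set.Icc (0 : ℝ) 1) := uniqueDiffOn_Icc zero_lt_one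
  have hm0 : (0 : ℝ) ∈ Set.Icc (0 : ℝ) 1 := by simp
  have hd0 : HasDerivWithinAt ebar 0 (Set.Icc 0 1) 0 := by
    simpa [h'0] using ((hC2.differentiableOn (by simp)) 0 hm0).hasDerivWithinAt
  have hcont := continuousOn_sub_one_div_self hC2.continuousOn h0 hd0
  let p : ℝ → ℝ := Set.IccExtend zero_le_one
    ((Set.Icc (0 : ℝ) 1).domRestrict fun s => (ebar s - 1) / s)
  have hp : Continuous p := hcont.domRestrict.Icc_extend'
  have hpval : ∀ s ∈ Set.Icc (0 : ℝ) 1, p s = (ebar s - 1) / s := fun s hs => by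
    simp [p, Set.IccExtend_of_mem _ _ hs, Set.domRestrict_apply]
  have hpe : ∀ s ∈ Set.Icc (0 : ℝ) 1, s * p s = ebar s - 1 := fun s hs => by
    rw [hpval s hs]
    rcases eq_or_ne s 0 with rfl | hs0
    · simp [h0]
    · field_simp
  let W : ℝ → ℝ := fun r => v₀ / r₀ * Real.exp (∫ s in r₀..r, p s)
  have hWpos : ∀ r, 0 < W r := fun r => mul_pos (div_pos hv₀ hr₀.1) (Real.exp_pos _)
  have hW : ∀ r, HasDerivAt W (W r * p r) r := fun r => by
    have := ((hp.integral_hasStrictDerivAt r₀ r).hasDerivAt.exp).const_mul (v₀ / r₀)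
    simpa [W, mul_assoc] using this
  have hvW : ∀ r ∈ Set.Icc (0 : ℝ) 1, v r = r * W r := fun r hr => by
    rcases hr.1.eq_or_lt with rfl | hpos
    · simp [hv0]
    · rw [hv r ⟨hpos, hr.2⟩, exp_integral_div_self hp hpe hr₀ ⟨hpos, hr.2⟩]
      simp only [W]
      ring
  have hdv : ∀ r ∈ Set.Icc (0 : ℝ) 1,
      HasDerivWithinAt v (W r * ebar r) (Set.Icc 0 1) r := fun r hr => by
    have := ((hasDerivAt_id r).mul (hW r)).hasDerivWithinAt (s := Set.Icc 0 1)
    refine (this.congr hvW (hvW r hr)).congr_deriv ?_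
    simp only [id]
    linear_combination W r * hpe r hr
  have hdv' : Set.EqOn (derivWithin v (Set.Icc 0 1)) (fun r => W r * ebar r)
      (Set.Icc 0 1) := fun r hr => (hdv r hr).derivWithin (hU r hr)
  have hWC1 : ContDiff ℝ 1 W := by
    rw [contDiff_one_iff_deriv]
    have hWd : Differentiable ℝ W := fun r => (hW r).differentiableAt
    refine ⟨hWd, ?_⟩
    rw [show deriv W = fun r => W r * p r from funext fun r => (hW r).deriv]
    exact hWd.continuous.mul hp
  refine ⟨?_, hv0, ?_, ?_⟩
  · rw [show (2 : WithTop ℕ∞) = 1 + 1 by norm_num, contDiffOn_succ_iff_derivWithin hU]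
    refine ⟨fun r hr => (hdv r hr).differentiableWithinAt, by simp, ?_⟩
    exact (hWC1.contDiffOn.mul (hC2.of_le one_le_two)).congr hdv'
  · rw [hdv' hm0]
    simpa [h0] using hWpos 0
  · rw [iteratedDerivWithin_succ, iteratedDerivWithin_one, derivWithin_congr hdv' (hdv' hm0)]
    have h := ((hW 0).hasDerivWithinAt (s := Set.Icc 0 1)).mul hd0
    have hp0 : p 0 = 0 := by simp [hpval 0 hm0]
    exact (h.derivWithin (hU 0 hm0)).trans (by simp [hp0])
end

section
/- Let η₀ > 1, and let α, σ be real numbers with 0 < σ ≤ α. Let φ : [1, η₀] → ℝ be twice continuously differentiable with φ(1) = 0, φ'(1) = 2, and α − σ ≤ φ''(η) ≤ α + σ for all η ∈ [1, η₀]. Then for every η ∈ (1, η₀): (1/φ(η))·exp(∫_{η₀}^{η} (s+1)/φ(s) ds) ≤ ((α+σ)/8)·(η₀ − 1 + 4/(α+σ))/(η₀ − 1). -/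
/-- Comparison principle: an inequality between functions at the left endpoint and between their
derivatives in the interior propagates to the whole interval. -/
theorem le_on_Icc_of_hasDerivAt_le {a b : ℝ} {f g f' g' : ℝ → ℝ}
    (hf : ContinuousOn f (Set.Icc a b)) (hg : ContinuousOn g (Set.Icc a b))
    (hf' : ∀ x ∈ Set.Ioo a b, HasDerivAt f (f' x) x)
    (hg' : ∀ x ∈ Set.Ioo a b, HasDerivAt g (g' x) x)
    (hle : ∀ x ∈ Set.Ioo a b, f' x ≤ g' x) (ha : f a ≤ g a) :
    ∀ x ∈ Set.Icc a b, f x ≤ g x := by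
  intro x hx
  have hmono : MonotoneOn (fun x => g x - f x) (Set.Icc a b) := by
    refine monotoneOn_of_deriv_nonneg (convex_Icc a b) (hg.sub hf) ?_ ?_
    · rw [interior_Icc]
      exact fun y hy => ((hg' y hy).sub (hf' y hy)).differentiableAt.differentiableWithinAt
    · rw [interior_Icc]
      intro y hy
      have h := ((hg' y hy).sub (hf' y hy)).deriv
      have h2 := hle y hy
      change 0 ≤ deriv (g - f) y
      rw [h]
      linarith
  have h := hmono (Set.left_mem_Icc.2 (hx.1.trans hx.2)) hx hx.1
  simp only at h
  linarith

/-- Second order Taylor bounds from two-sided bounds on the second derivative. -/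
theorem taylor_bounds_of_iteratedDerivWithin_two {a b d m M : ℝ} (hab : a < b) {φ : ℝ → ℝ}
    (hφ : ContDiffOn ℝ 2 φ (Set.Icc a b)) (hφa : φ a = 0)
    (hφ'a : derivWithin φ (Set.Icc a b) a = d)
    (hφ'' : ∀ x ∈ Set.Icc a b, m ≤ iteratedDerivWithin 2 φ (Set.Icc a b) x ∧
      iteratedDerivWithin 2 φ (Set.Icc a b) x ≤ M) :
    ∀ x ∈ Set.Icc a b, d * (x - a) + m / 2 * (x - a) ^ 2 ≤ φ x ∧
      φ x ≤ d * (x - a) + M / 2 * (x - a) ^ 2 := by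
  have hu := uniqueDiffOn_Icc hab
  have hD : ContDiffOn ℝ 1 (derivWithin φ (Set.Icc a b)) (Set.Icc a b) :=
    hφ.derivWithin hu (by norm_num)
  have hφd : ∀ x ∈ Set.Ioo a b, HasDerivAt φ (derivWithin φ (Set.Icc a b) x) x := fun x hx =>
    ((hφ.differentiableOn (by norm_num)) x
      (Set.Ioo_subset_Icc_self hx)).hasDerivWithinAt.hasDerivAt (Icc_mem_nhds hx.1 hx.2)
  have hDd : ∀ x ∈ Set.Ioo a b, HasDerivAt (derivWithin φ (Set.Icc a b))
      (iteratedDerivWithin 2 φ (Set.Icc a b) x) x := by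
    intro x hx
    have h := ((hD.differentiableOn (by norm_num)) x
      (Set.Ioo_subset_Icc_self hx)).hasDerivWithinAt.hasDerivAt (Icc_mem_nhds hx.1 hx.2)
    rw [iteratedDerivWithin_succ, iteratedDerivWithin_one]
    exact h
  have hlin : ∀ k x : ℝ, HasDerivAt (fun x => d + k * (x - a)) k x := fun k x => by
    simpa using (((hasDerivAt_id x).sub_const a).const_mul k).const_add d
  have hquad : ∀ k x : ℝ,
      HasDerivAt (fun x => d * (x - a) + k / 2 * (x - a) ^ 2) (d + k * (x - a)) x := fun k x => by
    have h := (hasDerivAt_id x).sub_const a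
    refine ((h.const_mul d).add ((h.pow 2).const_mul (k / 2))).congr_deriv ?_
    simp
    ring
  have hlower := le_on_Icc_of_hasDerivAt_le (f := fun x => d + m * (x - a))
    (f' := fun _ => m) (by fun_prop) hD.continuousOn (fun x _ => hlin m x) hDd
    (fun x hx => (hφ'' x (Set.Ioo_subset_Icc_self hx)).1) (by simp [hφ'a])
  have hupper := le_on_Icc_of_hasDerivAt_le (g := fun x => d + M * (x - a))
    (g' := fun _ => M) hD.continuousOn (by fun_prop) hDd (fun x _ => hlin M x)
    (fun x hx => (hφ'' x (Set.Ioo_subset_Icc_self hx)).2) (by simp [hφ'a])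
  intro x hx
  exact ⟨le_on_Icc_of_hasDerivAt_le (f := fun x => d * (x - a) + m / 2 * (x - a) ^ 2)
      (by fun_prop) hφ.continuousOn (fun x _ => hquad m x) hφd
      (fun x hx => hlower x (Set.Ioo_subset_Icc_self hx)) (by simp [hφa]) x hx,
    le_on_Icc_of_hasDerivAt_le (g := fun x => d * (x - a) + M / 2 * (x - a) ^ 2)
      hφ.continuousOn (by fun_prop) hφd (fun x _ => hquad M x)
      (fun x hx => hupper x (Set.Ioo_subset_Icc_self hx)) (by simp [hφa]) x hx⟩

/-- Upper bound for the nonlocal quantity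
`Φ(η) = (1/φ(η))·exp(∫_{η₀}^η (s+1)/φ(s) ds)` under two-sided bounds
`α − σ ≤ φ'' ≤ α + σ` and the initial conditions `φ(1) = 0`, `φ'(1) = 2`. -/
theorem stmt_13 (η₀ α σ : ℝ) (hη₀ : 1 < η₀) (hσ : 0 < σ) (hσα : σ ≤ α)
    (φ : ℝ → ℝ) (hφ : ContDiffOn ℝ 2 φ (Set.Icc 1 η₀))
    (hφ1 : φ 1 = 0) (hφ'1 : derivWithin φ (Set.Icc 1 η₀) 1 = 2)
    (hφ'' : ∀ η ∈ Set.Icc (1:ℝ) η₀,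
      α - σ ≤ iteratedDerivWithin 2 φ (Set.Icc 1 η₀) η ∧
        iteratedDerivWithin 2 φ (Set.Icc 1 η₀) η ≤ α + σ) :
    ∀ η ∈ Set.Ioo (1:ℝ) η₀,
      1 / φ η * Real.exp (∫ s in η₀..η, (s + 1) / φ s)
        ≤ (α + σ) / 8 * ((η₀ - 1 + 4 / (α + σ)) / (η₀ - 1)) := by
  intro η hη
  obtain ⟨h1η, hηη₀⟩ := hη
  have hM : 0 < α + σ := by linarith
  set c := 4 / (α + σ) with hc
  have hc0 : 0 < c := by positivity
  have hMc : α + σ = 4 / c := by rw [hc]; field_simp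
  have hbounds := taylor_bounds_of_iteratedDerivWithin_two hη₀ hφ hφ1 hφ'1 hφ''
  have hlow : ∀ s ∈ Set.Icc 1 η₀, 2 * (s - 1) ≤ φ s := fun s hs => by
    have h := (hbounds s hs).1
    have : 0 ≤ (α - σ) / 2 * (s - 1) ^ 2 := mul_nonneg (by linarith) (sq_nonneg _)
    linarith
  have hsub : Set.Icc η η₀ ⊆ Set.Icc 1 η₀ := Set.Icc_subset_Icc_left h1η.le
  have hpos : ∀ s ∈ Set.Icc η η₀, 0 < φ s := fun s hs => by
    linarith [hlow s (hsub hs), hs.1]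
  have hcont : ContinuousOn (fun s => (s + 1) / φ s) (Set.Icc η η₀) :=
    (by fun_prop : ContinuousOn (fun s : ℝ => s + 1) (Set.Icc η η₀)).div
      (hφ.continuousOn.mono hsub) fun s hs => (hpos s hs).ne'
  have hcont' : ContinuousOn (fun s => 1 / (s - 1) - 1 / (s - 1 + c)) (Set.Icc η η₀) := by
    refine ContinuousOn.sub (ContinuousOn.div (by fun_prop) (by fun_prop) ?_)
      (ContinuousOn.div (by fun_prop) (by fun_prop) ?_) <;>
    · intro s hs
      have := hs.1
      exact ne_of_gt (by linarith)
  have hle : ∀ s ∈ Set.Icc η η₀, 1 / (s - 1) - 1 / (s - 1 + c) ≤ (s + 1) / φ s := by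
    intro s hs
    have hu : 0 < s - 1 := by linarith [hs.1]
    have hup := (hbounds s (hsub hs)).2
    have heq : 1 / (s - 1) - 1 / (s - 1 + c)
        = 2 / (2 * (s - 1) + (α + σ) / 2 * (s - 1) ^ 2) := by
      rw [hMc]
      field_simp
      ring
    rw [heq]
    exact div_le_div₀ (by linarith) (by linarith) (hpos s hs) hup
  have hint : ∫ s in η..η₀, (1 / (s - 1) - 1 / (s - 1 + c))
      = (Real.log (η₀ - 1) - Real.log (η₀ - 1 + c))
        - (Real.log (η - 1) - Real.log (η - 1 + c)) := by
    refine intervalIntegral.integral_eq_sub_of_hasDerivAt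
      (f := fun s => Real.log (s - 1) - Real.log (s - 1 + c)) ?_
      (hcont'.intervalIntegrable_of_Icc hηη₀.le)
    intro s hs
    rw [Set.uIcc_of_le hηη₀.le] at hs
    have hu : 0 < s - 1 := by linarith [hs.1]
    have h := (hasDerivAt_id s).sub_const 1
    exact (h.log hu.ne').sub ((h.add_const c).log (add_pos hu hc0).ne')
  have hmono := intervalIntegral.integral_mono_on (μ := MeasureTheory.volume) hηη₀.le
    (hcont'.intervalIntegrable_of_Icc hηη₀.le) (hcont.intervalIntegrable_of_Icc hηη₀.le) hle
  rw [hint] at hmono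
  have hu : 0 < η - 1 := by linarith
  have hU : 0 < η₀ - 1 := by linarith
  have hexp : Real.exp (∫ s in η₀..η, (s + 1) / φ s)
      ≤ (η - 1) * (η₀ - 1 + c) / ((η₀ - 1) * (η - 1 + c)) := by
    rw [← Real.le_log_iff_exp_le (by positivity), intervalIntegral.integral_symm,
      Real.log_div (by positivity) (by positivity), Real.log_mul (by positivity) (by positivity),
      Real.log_mul (by positivity) (by positivity)]
    linarith
  calc 1 / φ η * Real.exp (∫ s in η₀..η, (s + 1) / φ s)
      ≤ 1 / (2 * (η - 1)) * ((η - 1) * (η₀ - 1 + c) / ((η₀ - 1) * (η - 1 + c))) := by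
        refine mul_le_mul ?_ hexp (Real.exp_pos _).le (by positivity)
        exact one_div_le_one_div_of_le (by positivity) (hlow η ⟨h1η.le, hηη₀.le⟩)
    _ = (η₀ - 1 + c) / (2 * (η₀ - 1)) * (1 / (η - 1 + c)) := by
        field_simp
    _ ≤ (η₀ - 1 + c) / (2 * (η₀ - 1)) * (1 / c) := by
        gcongr
        linarith
    _ = (α + σ) / 8 * ((η₀ - 1 + c) / (η₀ - 1)) := by
        rw [hMc]
        field_simp
        ring
end

section
/- Let n ≥ 2 be an integer, θ > 0, and let k ≥ 3 be an integer such that ς := (1/(2k))·(4 + n(n−2)/2) − n(n−2)/(4(k+1)) lies in (0,1). Then there exist η₀ > 1, a constant λ > 0, and a function ζ : [1, η₀] → ℝ that is (k+1) times continuously differentiable on [1, η₀], positive on (1, η₀], with ζ(1) = 0 and ζ'(1) = 2, satisfying for all η ∈ (1, η₀]: −ζ(η)ζ'(η) + (θ+1)ζ(η)²/η + ζ(η)·((2nθ−(2n−1))η − (2nθ−1)) + n·η·(η−1)·((nθ−(n−1))η − (nθ−1)) = −λ·η²·exp(∫_{η₀}^{η} (s+1)/ζ(s) ds). -/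
open Filter Topology

theorem exists_seq_recurrence_geometric_bound {E : Type*} [NormedAddCommGroup E]
    (B : E → E → E) (L : ℕ → E → E) (u : E) {C Q : ℝ} (hC : 0 ≤ C) (hQ : 0 ≤ Q)
    (hB : ∀ v w, ‖B v w‖ ≤ Q * (‖v‖ * ‖w‖))
    (hL : ∀ j : ℕ, 2 ≤ j → ∀ v, ‖L j v‖ ≤ C / j * ‖v‖) :
    ∃ X : ℕ → E, X 0 = 0 ∧ X 1 = u ∧
      (∀ j, 2 ≤ j → X j = L j (∑ i ∈ Finset.range (j + 1), B (X i) (X (j - i)))) ∧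
      ∃ K : ℝ, 0 < K ∧ ∀ j, ‖X j‖ ≤ ‖u‖ * K ^ j := by
  let X : ℕ → E := fun j => Nat.strongRec (motive := fun _ => E) (fun j ih =>
    if j = 0 then 0 else if j = 1 then u else
      L j (∑ i : Fin (j + 1), if hi : 0 < i.1 ∧ i.1 < j then
        B (ih i.1 hi.2) (ih (j - i.1) (by omega)) else 0)) j
  have hB0 : ∀ v, B 0 v = 0 := fun v => by simpa using hB 0 v
  have hB0' : ∀ v, B v 0 = 0 := fun v => by simpa using hB v 0
  have hX : ∀ j, X j = if j = 0 then 0 else if j = 1 then u else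
      L j (∑ i : Fin (j + 1), if 0 < i.1 ∧ i.1 < j then B (X i.1) (X (j - i.1)) else 0) := by
    intro j
    simp only [X]
    rw [Nat.strongRec]
    simp
  have hX0 : X 0 = 0 := by rw [hX]; simp
  have hX1 : X 1 = u := by rw [hX]; simp
  have hXj : ∀ j, 2 ≤ j →
      X j = L j (∑ i ∈ Finset.range (j + 1), B (X i) (X (j - i))) := by
    intro j hj
    rw [hX, if_neg (by omega), if_neg (by omega), Finset.sum_range]
    congr 1
    refine Finset.sum_congr rfl fun i _ => ?_
    split_ifs with hi
    · rfl
    · obtain h | h : i.1 = 0 ∨ i.1 = j := by omega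
      · rw [h, hX0, hB0]
      · rw [h, Nat.sub_self, hX0, hB0']
  set K : ℝ := 2 * C * Q * ‖u‖ + 1 with hK
  have hK1 : 1 ≤ K := by
    have : 0 ≤ 2 * C * Q * ‖u‖ := by positivity
    linarith
  have hK0 : 0 < K := by linarith
  have hbound : ∀ j, ‖X j‖ ≤ ‖u‖ * K ^ (j - 1) := by
    intro j
    induction j using Nat.strong_induction_on with
    | _ j ih =>
      match j, ih with
      | 0, _ => simp [hX0]
      | 1, _ => simp [hX1]
      | j + 2, ih =>
        have hterm : ∀ i ∈ Finset.range (j + 2 + 1),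
            ‖B (X i) (X (j + 2 - i))‖ ≤ Q * ‖u‖ ^ 2 * K ^ j := by
          intro i hi
          by_cases h : 0 < i ∧ i < j + 2
          · calc ‖B (X i) (X (j + 2 - i))‖
                ≤ Q * (‖X i‖ * ‖X (j + 2 - i)‖) := hB _ _
              _ ≤ Q * ((‖u‖ * K ^ (i - 1)) * (‖u‖ * K ^ (j + 2 - i - 1))) := by
                gcongr
                · exact ih i h.2
                · exact ih _ (by omega)
              _ = Q * ‖u‖ ^ 2 * K ^ ((i - 1) + (j + 2 - i - 1)) := by rw [pow_add]; ring
              _ = Q * ‖u‖ ^ 2 * K ^ j := by rw [show (i - 1) + (j + 2 - i - 1) = j by omega]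
          · rw [Finset.mem_range] at hi
            have h0 : B (X i) (X (j + 2 - i)) = 0 := by
              obtain h | h : i = 0 ∨ i = j + 2 := by omega
              · rw [h, hX0, hB0]
              · rw [h, Nat.sub_self, hX0, hB0']
            rw [h0, norm_zero]
            positivity
        have hsum := (norm_sum_le_of_le _ hterm)
        rw [Finset.sum_const, Finset.card_range, nsmul_eq_mul] at hsum
        have hj : (((j + 2 + 1 : ℕ) : ℝ)) ≤ 2 * ((j + 2 : ℕ) : ℝ) := by
          push_cast
          linarith [(Nat.cast_nonneg j : (0 : ℝ) ≤ j)]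
        rw [hXj _ (by omega)]
        calc _ ≤ C / ((j + 2 : ℕ) : ℝ) * ‖∑ i ∈ Finset.range (j + 2 + 1),
                B (X i) (X (j + 2 - i))‖ := hL _ (by omega) _
          _ ≤ C / ((j + 2 : ℕ) : ℝ) * (2 * ((j + 2 : ℕ) : ℝ) * (Q * ‖u‖ ^ 2 * K ^ j)) := by
            gcongr
            exact hsum.trans (by gcongr)
          _ = ‖u‖ * ((2 * C * Q * ‖u‖) * K ^ j) := by
            have : ((j + 2 : ℕ) : ℝ) ≠ 0 := by positivity
            field_simp
          _ ≤ ‖u‖ * (K * K ^ j) := by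
            gcongr
            linarith
          _ = ‖u‖ * K ^ (j + 2 - 1) := by
            rw [show j + 2 - 1 = j + 1 by omega, pow_succ']
  refine ⟨X, hX0, hX1, hXj, K, hK0, fun j => (hbound j).trans ?_⟩
  gcongr
  exact Nat.sub_le j 1

section
variable {c : ℕ → ℝ} {M K : ℝ}

theorem summable_norm_mul_pow_of_geometric_bound (hK : 0 < K) (hc : ∀ j, |c j| ≤ M * K ^ j)
    {t : ℝ} (ht : |t| < K⁻¹) : Summable fun j => ‖c j * t ^ j‖ := by
  have hKt : K * |t| < 1 := by
    have := mul_lt_mul_of_pos_left ht hK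
    rwa [mul_inv_cancel₀ hK.ne'] at this
  refine Summable.of_nonneg_of_le (fun _ => norm_nonneg _) (fun j => ?_)
    ((summable_geometric_of_lt_one (by positivity) hKt).mul_left M)
  rw [norm_mul, norm_pow, Real.norm_eq_abs, Real.norm_eq_abs, mul_pow, ← mul_assoc]
  gcongr
  exact hc j

theorem summable_norm_natCast_mul_mul_pow (hK : 0 < K) (hc : ∀ j, |c j| ≤ M * K ^ j)
    {t : ℝ} (ht : |t| < K⁻¹) : Summable fun j : ℕ => (j : ℝ) * ‖c j * t ^ j‖ := by
  have hKt : ‖K * |t|‖ < 1 := by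
    have := mul_lt_mul_of_pos_left ht hK
    rwa [mul_inv_cancel₀ hK.ne', ← Real.norm_of_nonneg (show 0 ≤ K * |t| by positivity)] at this
  have hs : Summable fun j : ℕ => M * ((j : ℝ) ^ 1 * (K * |t|) ^ j) :=
    (summable_pow_mul_geometric_of_norm_lt_one (R := ℝ) 1 (r := K * |t|) hKt).mul_left M
  refine hs.of_nonneg_of_le (fun j => by positivity) fun j => ?_
  rw [norm_mul, norm_pow, Real.norm_eq_abs, Real.norm_eq_abs, mul_pow, pow_one]
  calc (j : ℝ) * (|c j| * |t| ^ j) ≤ j * (M * K ^ j * |t| ^ j) := by gcongr; exact hc j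
    _ = _ := by ring

theorem hasDerivAt_tsum_mul_pow (hK : 0 < K) (hc : ∀ j, |c j| ≤ M * K ^ j)
    {t : ℝ} (ht : |t| < K⁻¹) :
    HasDerivAt (fun s => ∑' j, c j * s ^ j) (∑' j : ℕ, c j * (j * t ^ (j - 1))) t := by
  obtain ⟨r, hr, hrK⟩ := exists_between ht
  have hr0 : 0 < r := (abs_nonneg t).trans_lt hr
  have hu := (summable_norm_natCast_mul_mul_pow hK hc
    (t := r) (by rwa [abs_of_pos hr0])).mul_left r⁻¹
  refine hasDerivAt_tsum_of_isPreconnected (t := Metric.ball 0 r) (y₀ := 0) hu Metric.isOpen_ball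
    (convex_ball _ _).isPreconnected (fun j s _ => (hasDerivAt_pow j s).const_mul (c j))
    (fun j s hs => ?_) (by simpa using hr0) ?_ (by simpa using hr)
  · rw [mem_ball_zero_iff, Real.norm_eq_abs] at hs
    rcases j with _ | j
    · simp
    · have hM : r⁻¹ * (((j + 1 : ℕ) : ℝ) * ‖c (j + 1) * r ^ (j + 1)‖)
          = |c (j + 1)| * (((j + 1 : ℕ) : ℝ) * r ^ j) := by
        rw [norm_mul, norm_pow, Real.norm_eq_abs, Real.norm_eq_abs, abs_of_pos hr0]
        field_simp
        ring
      rw [hM, norm_mul, norm_mul, norm_pow, Real.norm_natCast, Real.norm_eq_abs, Real.norm_eq_abs,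
        Nat.add_sub_cancel]
      gcongr
  · exact (summable_norm_mul_pow_of_geometric_bound hK hc (by simpa using hK)).of_norm

theorem hasSum_mul_deriv_tsum_mul_pow (hK : 0 < K) (hc : ∀ j, |c j| ≤ M * K ^ j)
    {t : ℝ} (ht : |t| < K⁻¹) :
    HasSum (fun j : ℕ => j * (c j * t ^ j)) (t * deriv (fun s => ∑' j, c j * s ^ j) t) := by
  have hs : Summable fun j : ℕ => j * (c j * t ^ j) :=
    .of_norm_bounded (summable_norm_natCast_mul_mul_pow hK hc ht) fun j => by
      rw [norm_mul, Real.norm_natCast]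
  rw [(hasDerivAt_tsum_mul_pow hK hc ht).deriv, ← tsum_mul_left]
  convert hs.hasSum using 1
  refine tsum_congr fun j => ?_
  rcases j with _ | j
  · simp
  · rw [Nat.add_sub_cancel]; ring

theorem analyticAt_tsum_mul_pow (hK : 0 < K) (hc : ∀ j, |c j| ≤ M * K ^ j) :
    AnalyticAt ℝ (fun s => ∑' j, c j * s ^ j) 0 := by
  have hrad : ((K⁻¹).toNNReal : ENNReal) ≤ (FormalMultilinearSeries.ofScalars ℝ c).radius := by
    refine FormalMultilinearSeries.le_radius_of_bound _ M fun j => ?_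
    rw [FormalMultilinearSeries.ofScalars_norm, Real.coe_toNNReal _ (by positivity),
      Real.norm_eq_abs, inv_pow, ← div_eq_mul_inv, div_le_iff₀ (by positivity)]
    exact hc j
  have := (FormalMultilinearSeries.hasFPowerSeriesOnBall _
    (lt_of_lt_of_le (by simpa using hK) hrad)).analyticAt
  convert this using 1
  ext s
  simp [FormalMultilinearSeries.sum, mul_comm]

end

theorem norm_le_of_abs_le {v : ℝ × ℝ × ℝ} {r : ℝ} (h₁ : |v.1| ≤ r) (h₂ : |v.2.1| ≤ r)
    (h₃ : |v.2.2| ≤ r) : ‖v‖ ≤ r := by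
  rw [Prod.norm_def, Prod.norm_def]
  exact max_le h₁ (max_le h₂ h₃)

theorem abs_fst_le_norm (v : ℝ × ℝ × ℝ) : |v.1| ≤ ‖v‖ := norm_fst_le v

theorem abs_snd_fst_le_norm (v : ℝ × ℝ × ℝ) : |v.2.1| ≤ ‖v‖ :=
  (norm_fst_le v.2).trans (norm_snd_le v)

theorem abs_snd_snd_le_norm (v : ℝ × ℝ × ℝ) : |v.2.2| ≤ ‖v‖ :=
  (norm_snd_le v.2).trans (norm_snd_le v)

/-- The quadratic part of the autonomous system satisfied by `η - 1`, `ζ / η` and the right-hand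
side divided by `η`. -/
def quadPart (n θ : ℝ) (v w : ℝ × ℝ × ℝ) : ℝ × ℝ × ℝ :=
  (v.1 * w.2.1,
    θ * (v.2.1 * w.2.1) + (2 * n * θ - (2 * n - 1)) * (v.1 * w.2.1)
      + n * (n * θ - (n - 1)) * (v.1 * w.1),
    v.1 * w.2.2 + v.2.1 * w.2.2)

/-- The inverse of `m - A`, where `A` is the linear part of the same system; `A` has the
eigenvalues `2`, `-n` and `-(n - 2)`. -/
noncomputable def linResolvent (n m : ℝ) (s : ℝ × ℝ × ℝ) : ℝ × ℝ × ℝ :=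
  ((s.2.1 - s.2.2 / (m - 2) + (m + 2 * n - 2) * s.1) / ((m + n) * (m + n - 2)),
    (m * (s.2.1 - s.2.2 / (m - 2)) - n * (n - 2) * s.1) / ((m + n) * (m + n - 2)),
    s.2.2 / (m - 2))

theorem norm_quadPart_le (n θ : ℝ) (v w : ℝ × ℝ × ℝ) :
    ‖quadPart n θ v w‖ ≤ (|θ| + |2 * n * θ - (2 * n - 1)| + |n * (n * θ - (n - 1))| + 2)
      * (‖v‖ * ‖w‖) := by
  have hxx : |v.1 * w.1| ≤ ‖v‖ * ‖w‖ := by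
    rw [abs_mul]; gcongr; exacts [abs_fst_le_norm v, abs_fst_le_norm w]
  have hxy : |v.1 * w.2.1| ≤ ‖v‖ * ‖w‖ := by
    rw [abs_mul]; gcongr; exacts [abs_fst_le_norm v, abs_snd_fst_le_norm w]
  have hxh : |v.1 * w.2.2| ≤ ‖v‖ * ‖w‖ := by
    rw [abs_mul]; gcongr; exacts [abs_fst_le_norm v, abs_snd_snd_le_norm w]
  have hyy : |v.2.1 * w.2.1| ≤ ‖v‖ * ‖w‖ := by
    rw [abs_mul]; gcongr; exacts [abs_snd_fst_le_norm v, abs_snd_fst_le_norm w]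
  have hyh : |v.2.1 * w.2.2| ≤ ‖v‖ * ‖w‖ := by
    rw [abs_mul]; gcongr; exacts [abs_snd_fst_le_norm v, abs_snd_snd_le_norm w]
  have hN : 0 ≤ ‖v‖ * ‖w‖ := by positivity
  have h₁ := mul_nonneg (abs_nonneg θ) hN
  have h₂ := mul_nonneg (abs_nonneg (2 * n * θ - (2 * n - 1))) hN
  have h₃ := mul_nonneg (abs_nonneg (n * (n * θ - (n - 1)))) hN
  refine norm_le_of_abs_le ?_ ?_ ?_
  · change |v.1 * w.2.1| ≤ _
    linarith
  · refine (abs_add_three _ _ _).trans ?_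
    rw [abs_mul θ, abs_mul (2 * n * θ - (2 * n - 1)), abs_mul (n * (n * θ - (n - 1)))]
    have := mul_le_mul_of_nonneg_left hyy (abs_nonneg θ)
    have := mul_le_mul_of_nonneg_left hxy (abs_nonneg (2 * n * θ - (2 * n - 1)))
    have := mul_le_mul_of_nonneg_left hxx (abs_nonneg (n * (n * θ - (n - 1))))
    linarith
  · refine (abs_add_le _ _).trans ?_
    linarith

theorem norm_linResolvent_le {n m : ℝ} (hn : 2 ≤ n) (hm : 4 ≤ m) (s : ℝ × ℝ × ℝ) :
    ‖linResolvent n m s‖ ≤ (n + 4) / m * ‖s‖ := by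
  have h₁ := abs_fst_le_norm s
  have h₂ := abs_snd_fst_le_norm s
  have h₃ := abs_snd_snd_le_norm s
  have hN := norm_nonneg s
  have hh : |s.2.2 / (m - 2)| ≤ 2 / m * ‖s‖ := by
    rw [abs_div, abs_of_pos (by linarith : 0 < m - 2), div_le_iff₀ (by linarith)]
    have : 1 ≤ 2 / m * (m - 2) := by rw [div_mul_eq_mul_div, le_div_iff₀] <;> linarith
    nlinarith
  have hh' : |s.2.2 / (m - 2)| ≤ ‖s‖ := hh.trans
    (mul_le_of_le_one_left hN (by rw [div_le_one] <;> linarith))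
  have hsub : |s.2.1 - s.2.2 / (m - 2)| ≤ 2 * ‖s‖ := (abs_sub _ _).trans (by linarith)
  have hD : 0 < (m + n) * (m + n - 2) := mul_pos (by linarith) (by linarith)
  refine norm_le_of_abs_le ?_ ?_ ?_
  · change |_ / _| ≤ _
    rw [abs_div, abs_of_pos hD, div_le_iff₀ hD]
    calc _ ≤ |s.2.1 - s.2.2 / (m - 2)| + |(m + 2 * n - 2) * s.1| := abs_add_le _ _
      _ ≤ 2 * ‖s‖ + (m + 2 * n - 2) * ‖s‖ := by
        rw [abs_mul, abs_of_pos (by linarith : 0 < m + 2 * n - 2)]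
        gcongr
        linarith
      _ = (m + 2 * n) * ‖s‖ := by ring
      _ ≤ ((n + 4) / m * ((m + n) * (m + n - 2))) * ‖s‖ := by
        gcongr
        rw [div_mul_eq_mul_div, le_div_iff₀ (by linarith)]
        calc (m + 2 * n) * m ≤ ((n + 4) * (m + n)) * (m + n - 2) := by
              gcongr <;> nlinarith
          _ = _ := by ring
      _ = _ := by ring
  · change |_ / _| ≤ _
    rw [abs_div, abs_of_pos hD, div_le_iff₀ hD]
    calc _ ≤ |m * (s.2.1 - s.2.2 / (m - 2))| + |n * (n - 2) * s.1| := abs_sub _ _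
      _ ≤ m * (2 * ‖s‖) + n * (n - 2) * ‖s‖ := by
        rw [abs_mul, abs_mul (n * (n - 2)), abs_of_pos (by linarith : 0 < m),
          abs_of_nonneg (mul_nonneg (by linarith) (by linarith) : 0 ≤ n * (n - 2))]
        have : 0 ≤ n * (n - 2) := mul_nonneg (by linarith) (by linarith)
        gcongr
      _ = (2 * m + n * (n - 2)) * ‖s‖ := by ring
      _ ≤ ((n + 4) / m * ((m + n) * (m + n - 2))) * ‖s‖ := by
        gcongr
        rw [div_mul_eq_mul_div, le_div_iff₀ (by linarith)]
        calc (2 * m + n * (n - 2)) * m ≤ ((n + 4) * (m + n)) * (m + n - 2) := by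
              gcongr <;> nlinarith
          _ = _ := by ring
      _ = _ := by ring
  · refine hh.trans ?_
    gcongr
    linarith

theorem linResolvent_spec {n m : ℝ} (hn : 2 ≤ n) (hm : 4 ≤ m) {s v : ℝ × ℝ × ℝ}
    (h : v = linResolvent n m s) :
    m * v.1 = v.2.1 + s.1 ∧
    m * v.2.1 = -(2 * n - 2) * v.2.1 - n * (n - 2) * v.1 - v.2.2 + s.2.1 ∧
    m * v.2.2 = 2 * v.2.2 + s.2.2 := by
  have h₁ : m + n ≠ 0 := by linarith
  have h₂ : m + n - 2 ≠ 0 := by linarith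
  have h₃ : m - 2 ≠ 0 := by linarith
  subst h
  simp only [linResolvent]
  refine ⟨?_, ?_, ?_⟩ <;> field_simp <;> ring

/-- The unstable manifold of the stationary point: an analytic solution through the origin,
tangent to the eigenvector for the eigenvalue `2`, with time rescaled to `τ = exp (2 t)`. -/
theorem exists_analytic_solution {n : ℝ} (hn : 2 ≤ n) (θ : ℝ) :
    ∃ x y h : ℝ → ℝ, AnalyticAt ℝ x 0 ∧ AnalyticAt ℝ y 0 ∧ AnalyticAt ℝ h 0 ∧
      x 0 = 0 ∧ y 0 = 0 ∧ h 0 = 0 ∧ deriv x 0 = 1 ∧ deriv y 0 = 2 ∧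
      deriv h 0 = -(n * (n + 2)) ∧ ∀ᶠ τ in 𝓝 (0 : ℝ),
        2 * τ * deriv x τ = y τ + x τ * y τ ∧
        2 * τ * deriv y τ = -(2 * n - 2) * y τ - n * (n - 2) * x τ - h τ
          + (θ * (y τ * y τ) + (2 * n * θ - (2 * n - 1)) * (x τ * y τ)
            + n * (n * θ - (n - 1)) * (x τ * x τ)) ∧
        2 * τ * deriv h τ = 2 * h τ + (x τ * h τ + y τ * h τ) := by
  obtain ⟨X, hX0, hX1, hXj, K, hK, hXK⟩ := exists_seq_recurrence_geometric_bound
    (quadPart n θ) (fun j => linResolvent n (2 * j)) ((1, 2, -(n * (n + 2))) : ℝ × ℝ × ℝ)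
    (C := n + 4) (Q := |θ| + |2 * n * θ - (2 * n - 1)| + |n * (n * θ - (n - 1))| + 2)
    (by linarith) (by positivity) (norm_quadPart_le n θ) (fun j hj v => by
      have hj' : (2 : ℝ) ≤ j := by exact_mod_cast hj
      refine (norm_linResolvent_le hn (by linarith) v).trans ?_
      have : 0 ≤ n + 4 := by linarith
      gcongr
      linarith)
  set M := ‖((1, 2, -(n * (n + 2))) : ℝ × ℝ × ℝ)‖
  have hx : ∀ j, |(X j).1| ≤ M * K ^ j := fun j => (abs_fst_le_norm _).trans (hXK j)
  have hy : ∀ j, |(X j).2.1| ≤ M * K ^ j := fun j => (abs_snd_fst_le_norm _).trans (hXK j)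
  have hh : ∀ j, |(X j).2.2| ≤ M * K ^ j := fun j => (abs_snd_snd_le_norm _).trans (hXK j)
  have hrec : ∀ j : ℕ,
      2 * (j * (X j).1) = (X j).2.1 + ∑ i ∈ Finset.range (j + 1), (X i).1 * (X (j - i)).2.1 ∧
      2 * (j * (X j).2.1) = -(2 * n - 2) * (X j).2.1 - n * (n - 2) * (X j).1 - (X j).2.2
        + (θ * (∑ i ∈ Finset.range (j + 1), (X i).2.1 * (X (j - i)).2.1)
          + (2 * n * θ - (2 * n - 1)) * (∑ i ∈ Finset.range (j + 1), (X i).1 * (X (j - i)).2.1)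
          + n * (n * θ - (n - 1)) * (∑ i ∈ Finset.range (j + 1), (X i).1 * (X (j - i)).1)) ∧
      2 * (j * (X j).2.2) = 2 * (X j).2.2
        + ((∑ i ∈ Finset.range (j + 1), (X i).1 * (X (j - i)).2.2)
          + ∑ i ∈ Finset.range (j + 1), (X i).2.1 * (X (j - i)).2.2) := by
    intro j
    match j with
    | 0 => simp [hX0]
    | 1 =>
      simp [Finset.sum_range_succ, hX0, hX1]
      ring
    | j + 2 =>
      have hj : (4 : ℝ) ≤ 2 * ((j + 2 : ℕ) : ℝ) := by
        push_cast
        linarith [(Nat.cast_nonneg j : (0 : ℝ) ≤ j)]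
      obtain ⟨h₁, h₂, h₃⟩ := linResolvent_spec hn hj (hXj (j + 2) (by omega))
      rw [Prod.fst_sum] at h₁
      rw [Prod.snd_sum, Prod.fst_sum] at h₂
      rw [Prod.snd_sum, Prod.snd_sum] at h₃
      simp only [quadPart, Finset.sum_add_distrib, ← Finset.mul_sum] at h₁ h₂ h₃
      refine ⟨?_, ?_, ?_⟩
      · rw [← mul_assoc, h₁]
      · rw [← mul_assoc, h₂]
      · rw [← mul_assoc, h₃]
  have hcoeff : ∀ {c : ℕ → ℝ} (_ : ∀ j, |c j| ≤ M * K ^ j),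
      (∑' j, c j * (0 : ℝ) ^ j) = c 0 ∧ deriv (fun s => ∑' j, c j * s ^ j) 0 = c 1 := by
    intro c hc
    constructor
    · rw [tsum_eq_single 0 fun j hj => by simp [hj]]
      simp
    · rw [(hasDerivAt_tsum_mul_pow hK hc (by simpa using hK)).deriv,
        tsum_eq_single 1 fun j hj => ?_]
      · simp
      · obtain rfl | h : j = 0 ∨ 2 ≤ j := by omega
        · simp
        · rw [zero_pow (by omega)]; simp
  refine ⟨fun s => ∑' j, (X j).1 * s ^ j, fun s => ∑' j, (X j).2.1 * s ^ j,
    fun s => ∑' j, (X j).2.2 * s ^ j, analyticAt_tsum_mul_pow hK hx,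
    analyticAt_tsum_mul_pow hK hy, analyticAt_tsum_mul_pow hK hh,
    by simp [(hcoeff hx).1, hX0], by simp [(hcoeff hy).1, hX0], by simp [(hcoeff hh).1, hX0],
    by simp [(hcoeff hx).2, hX1], by simp [(hcoeff hy).2, hX1], by simp [(hcoeff hh).2, hX1], ?_⟩
  filter_upwards [Metric.ball_mem_nhds (0 : ℝ) (inv_pos.mpr hK)] with t ht
  rw [mem_ball_zero_iff, Real.norm_eq_abs] at ht
  have hsum : ∀ {c : ℕ → ℝ} (_ : ∀ j, |c j| ≤ M * K ^ j),
      HasSum (fun j => c j * t ^ j) (∑' j, c j * t ^ j) := fun hc =>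
    (summable_norm_mul_pow_of_geometric_bound hK hc ht).of_norm.hasSum
  have hprod : ∀ {c d : ℕ → ℝ} (_ : ∀ j, |c j| ≤ M * K ^ j) (_ : ∀ j, |d j| ≤ M * K ^ j),
      HasSum (fun j => (∑ i ∈ Finset.range (j + 1), c i * d (j - i)) * t ^ j)
        ((∑' j, c j * t ^ j) * ∑' j, d j * t ^ j) := by
    intro c d hc hd
    refine HasSum.congr_fun (hasSum_sum_range_mul_of_summable_norm
      (summable_norm_mul_pow_of_geometric_bound hK hc ht)
      (summable_norm_mul_pow_of_geometric_bound hK hd ht)) fun j => ?_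
    rw [Finset.sum_mul]
    refine Finset.sum_congr rfl fun i hi => ?_
    rw [mul_mul_mul_comm, ← pow_add, Nat.add_sub_of_le (by simpa [Nat.lt_succ_iff] using hi)]
  have hder : ∀ {c : ℕ → ℝ} (_ : ∀ j, |c j| ≤ M * K ^ j),
      HasSum (fun j : ℕ => 2 * (j * c j) * t ^ j)
        (2 * t * deriv (fun s => ∑' j, c j * s ^ j) t) := by
    intro c hc
    rw [mul_assoc]
    refine HasSum.congr_fun ((hasSum_mul_deriv_tsum_mul_pow hK hc ht).mul_left 2) fun j => ?_
    ring
  refine ⟨(hder hx).unique ?_, (hder hy).unique ?_, (hder hh).unique ?_⟩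
  · refine HasSum.congr_fun ((hsum hy).add (hprod hx hy)) fun j => ?_
    rw [(hrec j).1]
    ring
  · refine HasSum.congr_fun (((((hsum hy).mul_left (-(2 * n - 2))).sub ((hsum hx).mul_left (n * (n - 2)))).sub
      (hsum hh)).add ((((hprod hy hy).mul_left θ).add
        ((hprod hx hy).mul_left (2 * n * θ - (2 * n - 1)))).add
        ((hprod hx hx).mul_left (n * (n * θ - (n - 1)))))) fun j => ?_
    rw [(hrec j).2.1]
    ring
  · refine HasSum.congr_fun (((hsum hh).mul_left 2).add ((hprod hx hh).add (hprod hy hh))) fun j => ?_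
    rw [(hrec j).2.2]
    ring

theorem eventually_nhdsGT_pos_of_deriv_pos {f : ℝ → ℝ} (hf : 0 < deriv f 0) (h0 : f 0 = 0) :
    ∀ᶠ s in 𝓝[>] (0 : ℝ), 0 < f s := by
  filter_upwards [nhdsWithin_le_nhds (eventually_nhdsWithin_sign_eq_of_deriv_pos hf h0),
    self_mem_nhdsWithin] with s hs hs0
  rw [sub_zero, sign_pos (show 0 < s from hs0)] at hs
  exact sign_eq_one_iff.mp hs

/-- The functions `ξ = ζ / η` and `H` (the right-hand side divided by `η`), in the variable
`s = η - 1`: they are analytic at `s = 0` and satisfy a closed first-order system for `s > 0`. -/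
theorem exists_analytic_reduced_solution {n : ℝ} (hn : 2 ≤ n) (θ : ℝ) :
    ∃ ξ H : ℝ → ℝ, AnalyticAt ℝ ξ 0 ∧ AnalyticAt ℝ H 0 ∧ ξ 0 = 0 ∧ deriv ξ 0 = 2 ∧
      ∀ᶠ s in 𝓝[>] (0 : ℝ), 0 < ξ s ∧ H s < 0 ∧
        (1 + s) * ξ s * deriv ξ s = -(2 * n - 2) * ξ s - n * (n - 2) * s - H s
          + (θ * (ξ s * ξ s) + (2 * n * θ - (2 * n - 1)) * (s * ξ s)
            + n * (n * θ - (n - 1)) * (s * s)) ∧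
        (1 + s) * ξ s * deriv H s = 2 * H s + (s * H s + ξ s * H s) := by
  obtain ⟨x, y, h, hx, hy, hh, hx0, hy0, hh0, hx1, hy1, hh1, hsys⟩ :=
    exists_analytic_solution hn θ
  have hx1' : deriv x 0 ≠ 0 := by rw [hx1]; exact one_ne_zero
  let g := hx.hasStrictDerivAt.localInverse _ _ _ hx1'
  have hg : AnalyticAt ℝ g 0 := by simpa only [hx0] using hx.analyticAt_localInverse hx1'
  have hg0 : g 0 = 0 := by
    have : g (x 0) = 0 := HasStrictFDerivAt.localInverse_apply_image ..
    rwa [hx0] at this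
  have hxg : ∀ᶠ s in 𝓝 (0 : ℝ), x (g s) = s := by
    simpa only [hx0] using HasStrictDerivAt.eventually_right_inverse hx.hasStrictDerivAt hx1'
  have hg1 : deriv g 0 = 1 := by
    have : deriv g (x 0) = (deriv x 0)⁻¹ :=
      (hx.hasStrictDerivAt.to_localInverse hx1').hasDerivAt.deriv
    rwa [hx0, hx1, inv_one] at this
  have hgt : Tendsto g (𝓝 0) (𝓝 0) := by simpa only [hg0] using hg.continuousAt.tendsto
  have hyg : AnalyticAt ℝ (y ∘ g) 0 := AnalyticAt.comp (by rwa [hg0]) hg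
  have hhg : AnalyticAt ℝ (h ∘ g) 0 := AnalyticAt.comp (by rwa [hg0]) hg
  have hchain : ∀ {f : ℝ → ℝ} {s : ℝ}, AnalyticAt ℝ f (g s) → AnalyticAt ℝ g s →
      deriv (f ∘ g) s = deriv f (g s) * deriv g s := fun hf hgs =>
    deriv_comp _ hf.differentiableAt hgs.differentiableAt
  have hyg1 : deriv (y ∘ g) 0 = 2 := by
    rw [hchain (by rwa [hg0]) hg, hg0, hy1, hg1, mul_one]
  have hhg1 : deriv (h ∘ g) 0 = -(n * (n + 2)) := by
    rw [hchain (by rwa [hg0]) hg, hg0, hh1, hg1, mul_one]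
  have hneg : ∀ᶠ s in 𝓝[>] (0 : ℝ), 0 < -(h ∘ g) s :=
    eventually_nhdsGT_pos_of_deriv_pos (by
      rw [deriv.fun_neg, hhg1, neg_neg]
      exact mul_pos (by linarith) (by linarith)) (by simp [hg0, hh0])
  refine ⟨y ∘ g, h ∘ g, hyg, hhg, by simp [hg0, hy0], hyg1, ?_⟩
  filter_upwards [eventually_nhdsGT_pos_of_deriv_pos (by rw [hyg1]; exact two_pos)
      (show (y ∘ g) 0 = 0 by simp [hg0, hy0]), hneg,
    nhdsWithin_le_nhds hxg.eventually_nhds, nhdsWithin_le_nhds hg.eventually_analyticAt,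
    nhdsWithin_le_nhds (hgt.eventually hx.eventually_analyticAt),
    nhdsWithin_le_nhds (hgt.eventually hy.eventually_analyticAt),
    nhdsWithin_le_nhds (hgt.eventually hh.eventually_analyticAt),
    nhdsWithin_le_nhds (hgt.eventually hsys)] with s hpos hneg hxgs hgs hxs hys hhs hs
  obtain ⟨e₁, e₂, e₃⟩ := hs
  have hxs1 : deriv x (g s) * deriv g s = 1 := by
    rw [← hchain hxs hgs, (show x ∘ g =ᶠ[𝓝 s] id from hxgs).deriv_eq, deriv_id]
  have hxs0 : x (g s) = s := hxgs.self_of_nhds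
  rw [hxs0] at e₁ e₂ e₃
  simp only [Function.comp_apply] at hpos hneg ⊢
  have hvel : (1 + s) * y (g s) * deriv g s = 2 * g s := by
    linear_combination (-deriv g s) * e₁ + 2 * g s * hxs1
  refine ⟨hpos, by linarith, ?_, ?_⟩
  · rw [hchain hys hgs]
    linear_combination e₂ + deriv y (g s) * hvel
  · rw [hchain hhs hgs]
    linear_combination e₃ + deriv h (g s) * hvel


/-- High-dimensional local existence: for any `n ≥ 2`, `θ > 0`, and `k ≥ 3` with
`ς = (1/(2k))(4 + n(n−2)/2) − n(n−2)/(4(k+1)) ∈ (0,1)`, the nonlocal reduced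
eigenvalue equation (4.7) admits a positive `C^{k+1}` solution near `η = 1`
for some negative constant `−λ`. -/
theorem stmt_16 (n : ℕ) (hn : 2 ≤ n) (k : ℕ) (hk : 3 ≤ k) (θ : ℝ) (hθ : 0 < θ)
    (hς : 1 / (2 * (k:ℝ)) * (4 + (n:ℝ) * ((n:ℝ) - 2) / 2)
        - (n:ℝ) * ((n:ℝ) - 2) / (4 * ((k:ℝ) + 1)) ∈ Set.Ioo (0:ℝ) 1) :
    ∃ η₀ : ℝ, 1 < η₀ ∧ ∃ lam : ℝ, 0 < lam ∧ ∃ ζ : ℝ → ℝ,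
      ContDiffOn ℝ ((k + 1 : ℕ) : ℕ∞) ζ (Set.Icc 1 η₀) ∧
      (∀ η ∈ Set.Ioc (1:ℝ) η₀, 0 < ζ η) ∧
      ζ 1 = 0 ∧
      derivWithin ζ (Set.Icc 1 η₀) 1 = 2 ∧
      (∀ η ∈ Set.Ioc (1:ℝ) η₀,
        -(ζ η * derivWithin ζ (Set.Icc 1 η₀) η) + (θ + 1) * (ζ η) ^ 2 / η
        + ζ η * ((2 * (n:ℝ) * θ - (2 * (n:ℝ) - 1)) * η - (2 * (n:ℝ) * θ - 1))
        + (n:ℝ) * η * (η - 1)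
          * (((n:ℝ) * θ - ((n:ℝ) - 1)) * η - ((n:ℝ) * θ - 1))
        = -lam * η ^ 2 * Real.exp (∫ s in η₀..η, (s + 1) / ζ s)) := by
  obtain ⟨ξ, H, hξ, hH, hξ0, hξ1, hev⟩ :=
    exists_analytic_reduced_solution (n := n) (by exact_mod_cast hn) θ
  have hall := hev.and (nhdsWithin_le_nhds (hξ.eventually_analyticAt.and hH.eventually_analyticAt))
  obtain ⟨δ, hδ, hall⟩ := mem_nhdsGT_iff_exists_Ioc_subset.mp hall
  have hδ' : 0 < δ := hδ
  have hsub : ∀ {η : ℝ}, η ∈ Set.Ioc 1 (1 + δ) → η - 1 ∈ Set.Ioc 0 δ := fun hη =>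
    ⟨by linarith [hη.1], by linarith [hη.2]⟩
  have hξan : ∀ η ∈ Set.Icc 1 (1 + δ), AnalyticAt ℝ ξ (η - 1) := by
    intro η hη
    obtain rfl | h := hη.1.eq_or_lt
    · simpa using hξ
    · exact (hall (hsub ⟨h, hη.2⟩)).2.1
  have hξd : ∀ η ∈ Set.Icc 1 (1 + δ), HasDerivAt (fun η => η * ξ (η - 1))
      (ξ (η - 1) + η * deriv ξ (η - 1)) η := by
    intro η hη
    have h := (hξan η hη).differentiableAt.hasDerivAt.comp_sub_const η 1
    simpa using (hasDerivAt_id' η).fun_mul h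
  have hderiv : ∀ η ∈ Set.Icc 1 (1 + δ),
      derivWithin (fun η => η * ξ (η - 1)) (Set.Icc 1 (1 + δ)) η
        = ξ (η - 1) + η * deriv ξ (η - 1) := fun η hη =>
    (hξd η hη).hasDerivWithinAt.derivWithin (uniqueDiffOn_Icc (by linarith) η hη)
  refine ⟨1 + δ, by linarith, -(H δ / (1 + δ)), ?_, fun η => η * ξ (η - 1), ?_, ?_, ?_, ?_, ?_⟩
  · have := (hall (Set.right_mem_Ioc.mpr hδ')).1.2.1
    exact neg_pos.mpr (div_neg_of_neg_of_pos this (by linarith))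
  · intro η hη
    have : AnalyticAt ℝ (fun η => ξ (η - 1)) η :=
      AnalyticAt.fun_comp (hξan η hη) (analyticAt_id.sub analyticAt_const)
    exact (analyticAt_id.mul this).contDiffAt.contDiffWithinAt
  · intro η hη
    exact mul_pos (by linarith [hη.1]) (hall (hsub hη)).1.1
  · simp [hξ0]
  · rw [hderiv 1 (Set.left_mem_Icc.mpr (by linarith)), sub_self, hξ0, hξ1]
    norm_num
  · intro η hη
    have hη0 : 0 < η := by linarith [hη.1]
    have hint : ∫ s in (1 + δ)..η, (s + 1) / (s * ξ (s - 1))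
        = Real.log (-(H (η - 1) / η)) - Real.log (-(H δ / (1 + δ))) := by
      have hmem : ∀ s ∈ Set.uIcc (1 + δ) η, s ∈ Set.Ioc 1 (1 + δ) := by
        intro s hs
        rw [Set.uIcc_of_ge hη.2] at hs
        exact ⟨hη.1.trans_le hs.1, hs.2⟩
      have hFTC := intervalIntegral.integral_eq_sub_of_hasDerivAt (a := 1 + δ) (b := η)
        (f := fun s => Real.log (-(H (s - 1) / s))) (f' := fun s => (s + 1) / (s * ξ (s - 1)))
        (fun s hs => ?_) (ContinuousOn.intervalIntegrable fun s hs => ?_)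
      · simpa using hFTC
      · have hs' := hmem s hs
        have hs0 : 0 < s := by linarith [hs'.1]
        obtain ⟨⟨hpos, hneg, -, heq⟩, -, hHan⟩ := hall (hsub hs')
        have hG : -(H (s - 1) / s) ≠ 0 := by
          rw [neg_ne_zero]
          exact div_ne_zero hneg.ne hs0.ne'
        refine (((hHan.differentiableAt.hasDerivAt.comp_sub_const s 1).fun_div (hasDerivAt_id' s)
          hs0.ne').fun_neg.log hG).congr_deriv ?_
        have hHne := hneg.ne
        have hξne := hpos.ne'
        field_simp
        linear_combination heq
      · have hs' := hmem s hs
        have hs0 : 0 < s := by linarith [hs'.1]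
        have hne : s * ξ (s - 1) ≠ 0 := (mul_pos hs0 (hall (hsub hs')).1.1).ne'
        exact ((continuousAt_id.add continuousAt_const).div
          (hξd s ⟨hs'.1.le, hs'.2⟩).continuousAt hne).continuousWithinAt
    have hGpos : ∀ {s : ℝ}, s ∈ Set.Ioc 1 (1 + δ) → 0 < -(H (s - 1) / s) := fun hs =>
      neg_pos.mpr (div_neg_of_neg_of_pos (hall (hsub hs)).1.2.1 (by linarith [hs.1]))
    have hδpos : 0 < -(H δ / (1 + δ)) := by
      simpa using hGpos (Set.right_mem_Ioc.mpr (by linarith))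
    obtain ⟨⟨-, -, heq, -⟩, -⟩ := hall (hsub hη)
    rw [hint, Real.exp_sub, Real.exp_log (hGpos hη), Real.exp_log hδpos,
      hderiv η ⟨hη.1.le, hη.2⟩]
    have hHδ : H δ ≠ 0 := by rintro h; simp [h] at hδpos
    have h1δ : 1 + δ ≠ 0 := by linarith
    have hrhs : -(-(H δ / (1 + δ))) * η ^ 2 * (-(H (η - 1) / η) / -(H δ / (1 + δ)))
        = η * H (η - 1) := by
      field_simp
    rw [hrhs]
    field_simp
    linear_combination -heq
end

section
/- For every integer N ≥ 3 and every θ ∈ (1/2, (N−1)/N), there exist a nonempty open convex set Ω ⊆ ℝ^N and a function u : Ω → ℝ of class C⁵ such that: (i) the Hessian matrix D²u(x) is positive definite for every x ∈ Ω; (ii) trace((D²u(x))⁻¹ · D²w(x)) = 0 for every x ∈ Ω, where w(x) = (det D²u(x))^{−θ}; (iii) u is not a quadratic polynomial; and (iv) u(x_j) → +∞ for every sequence (x_j) in Ω converging to a point of the boundary ∂Ω. In particular, the graph of u is a Euclidean complete, locally uniformly convex hypersurface of affine maximal type in ℝ^{N+1} which is not an elliptic paraboloid, so the full Bernstein theorem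 in the sense of Trudinger–Wang fails for these N and θ. -/
/-- `f` coincides with a quadratic polynomial on `Ω`. -/
def IsQuadraticOn {ι : Type*} [Fintype ι] (f : (ι → ℝ) → ℝ)
    (Ω : Set (ι → ℝ)) : Prop :=
  ∃ (A : Matrix ι ι ℝ) (b : ι → ℝ) (c : ℝ),
    ∀ x ∈ Ω, f x = (∑ i, ∑ j, A i j * x i * x j) + (∑ i, b i * x i) + c

open Matrix Filter Topology

/-- The signature `(+, -, …, -)`, the positive direction being `i₀`. -/
noncomputable def lorentzSign {ι : Type*} [DecidableEq ι] (i₀ : ι) (i : ι) : ℝ :=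
  if i = i₀ then 1 else -1

/-- The Lorentzian inner product on `ι → ℝ` with time direction `i₀`. -/
noncomputable def lorentzForm {ι : Type*} [Fintype ι] [DecidableEq ι] (i₀ : ι)
    (x y : ι → ℝ) : ℝ :=
  ∑ i, lorentzSign i₀ i * x i * y i

/-- The open future light cone. -/
def lightCone {ι : Type*} [Fintype ι] [DecidableEq ι] (i₀ : ι) : Set (ι → ℝ) :=
  {x | 0 < x i₀ ∧ 0 < lorentzForm i₀ x x}

lemma lorentzSign_ne_zero {ι : Type*} [DecidableEq ι] (i₀ i : ι) : lorentzSign i₀ i ≠ 0 := by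
  unfold lorentzSign; split_ifs <;> norm_num

lemma tendsto_smul_single {ι : Type*} [DecidableEq ι] (i₀ : ι) :
    Tendsto (fun j : ℕ => (1 / ((j : ℝ) + 1)) • (Pi.single i₀ 1 : ι → ℝ)) atTop (𝓝 0) := by
  simpa only [zero_smul] using
    (tendsto_one_div_add_atTop_nhds_zero_nat (𝕜 := ℝ)).smul_const (Pi.single i₀ 1 : ι → ℝ)

section Lorentz

variable {ι : Type*} [Fintype ι] [DecidableEq ι] (i₀ : ι)

lemma lorentzForm_comm (x y : ι → ℝ) : lorentzForm i₀ x y = lorentzForm i₀ y x :=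
  Finset.sum_congr rfl fun i _ => by ring

lemma lorentzForm_add_right (x y z : ι → ℝ) :
    lorentzForm i₀ x (y + z) = lorentzForm i₀ x y + lorentzForm i₀ x z := by
  simp [lorentzForm, mul_add, Finset.sum_add_distrib]

lemma lorentzForm_smul_right (a : ℝ) (x y : ι → ℝ) :
    lorentzForm i₀ x (a • y) = a * lorentzForm i₀ x y := by
  simp only [lorentzForm, Finset.mul_sum, Pi.smul_apply, smul_eq_mul]
  exact Finset.sum_congr rfl fun i _ => by ring

lemma lorentzForm_eq (x y : ι → ℝ) :
    lorentzForm i₀ x y = x i₀ * y i₀ - ∑ i ∈ Finset.univ.erase i₀, x i * y i := by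
  rw [lorentzForm, ← Finset.add_sum_erase _ _ (Finset.mem_univ i₀), sub_eq_add_neg,
    ← Finset.sum_neg_distrib]
  congr 1
  · simp [lorentzSign]
  · refine Finset.sum_congr rfl fun i hi => ?_
    simp [lorentzSign, Finset.ne_of_mem_erase hi]

lemma lorentzForm_add_self (x y : ι → ℝ) :
    lorentzForm i₀ (x + y) (x + y) =
      lorentzForm i₀ x x + 2 * lorentzForm i₀ x y + lorentzForm i₀ y y := by
  rw [lorentzForm_add_right, lorentzForm_comm _ (x + y) x, lorentzForm_comm _ (x + y) y,
    lorentzForm_add_right, lorentzForm_add_right, lorentzForm_comm _ y x]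
  ring

lemma lorentzForm_smul_self (a : ℝ) (x : ι → ℝ) :
    lorentzForm i₀ (a • x) (a • x) = a ^ 2 * lorentzForm i₀ x x := by
  rw [lorentzForm_smul_right, lorentzForm_comm, lorentzForm_smul_right]
  ring

lemma lorentzForm_self_neg_of_apply_eq_zero {z : ι → ℝ} (h : z i₀ = 0) (hz : z ≠ 0) :
    lorentzForm i₀ z z < 0 := by
  rw [lorentzForm_eq, h, zero_mul, zero_sub, neg_lt_zero]
  obtain ⟨i, hi⟩ := Function.ne_iff.mp hz
  have hne : i ≠ i₀ := by rintro rfl; exact hi h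
  exact Finset.sum_pos' (fun j _ => mul_self_nonneg _)
    ⟨i, by simpa using hne, mul_self_pos.mpr hi⟩

/-- The reverse Cauchy–Schwarz inequality, with a quantitative gain. -/
lemma lorentzForm_reverse_cauchy_schwarz {x y : ι → ℝ} (hx : x ∈ lightCone i₀) (hy : y ≠ 0)
    {k : ℝ} (hk : 1 < k) :
    lorentzForm i₀ x x * lorentzForm i₀ y y < k * lorentzForm i₀ x y ^ 2 := by
  obtain ⟨hx0, hq⟩ := hx
  set l := y i₀ / x i₀
  set z := y + (-l) • x
  have hz0 : z i₀ = 0 := by simp [z, l, hx0.ne']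
  have hxz : lorentzForm i₀ x z = lorentzForm i₀ x y - l * lorentzForm i₀ x x := by
    rw [lorentzForm_add_right, lorentzForm_smul_right]; ring
  have hzz : lorentzForm i₀ z z = lorentzForm i₀ y y - 2 * l * lorentzForm i₀ x y
      + l ^ 2 * lorentzForm i₀ x x := by
    rw [lorentzForm_add_self, lorentzForm_smul_right, lorentzForm_smul_self,
      lorentzForm_comm _ y x]; ring
  have key : lorentzForm i₀ x y ^ 2 - lorentzForm i₀ x x * lorentzForm i₀ y y =
      lorentzForm i₀ x z ^ 2 - lorentzForm i₀ x x * lorentzForm i₀ z z := by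
    rw [hxz, hzz]; ring
  by_cases hz : z = 0
  · have hyx : y = l • x := by
      have : y + (-l) • x = 0 := hz
      rw [neg_smul, ← sub_eq_add_neg, sub_eq_zero] at this
      exact this
    have hl : l ≠ 0 := by
      intro h; rw [h, zero_smul] at hyx; exact hy hyx
    have hxy : lorentzForm i₀ x y = l * lorentzForm i₀ x x := by
      rw [hyx, lorentzForm_smul_right]
    have hpos : 0 < lorentzForm i₀ x y ^ 2 := by rw [hxy]; positivity
    have h0 : lorentzForm i₀ z z = 0 := by rw [hz]; simp [lorentzForm]
    rw [h0] at key
    nlinarith [sq_nonneg (lorentzForm i₀ x z)]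
  · have := mul_neg_of_pos_of_neg hq (lorentzForm_self_neg_of_apply_eq_zero i₀ hz0 hz)
    nlinarith [sq_nonneg (lorentzForm i₀ x z), sq_nonneg (lorentzForm i₀ x y)]

lemma lorentzForm_pos {x y : ι → ℝ} (hx : x ∈ lightCone i₀) (hy : y ∈ lightCone i₀) :
    0 < lorentzForm i₀ x y := by
  obtain ⟨hx0, hxq⟩ := hx
  obtain ⟨hy0, hyq⟩ := hy
  rw [lorentzForm_eq] at *
  have hcs := Finset.sum_mul_sq_le_sq_mul_sq (Finset.univ.erase i₀) x y
  simp only [sq (x _), sq (y _)] at hcs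
  have hS : 0 ≤ ∑ i ∈ Finset.univ.erase i₀, x i * x i :=
    Finset.sum_nonneg fun i _ => mul_self_nonneg _
  have hT : 0 ≤ ∑ i ∈ Finset.univ.erase i₀, y i * y i :=
    Finset.sum_nonneg fun i _ => mul_self_nonneg _
  have hlt : (∑ i ∈ Finset.univ.erase i₀, x i * y i) ^ 2 < (x i₀ * y i₀) ^ 2 := by
    refine hcs.trans_lt ?_
    rw [mul_pow, sq, sq]
    exact mul_lt_mul'' (by linarith) (by linarith) hS hT
  have := lt_of_abs_lt (abs_lt_of_sq_lt_sq hlt (by positivity))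
  linarith

lemma convex_lightCone : Convex ℝ (lightCone i₀) := by
  rw [convex_iff_forall_pos]
  intro x hx y hy a b ha hb _
  have hxy := lorentzForm_pos i₀ hx hy
  obtain ⟨hx0, hxq⟩ := hx
  obtain ⟨hy0, hyq⟩ := hy
  refine ⟨?_, ?_⟩
  · simp only [Pi.add_apply, Pi.smul_apply, smul_eq_mul]; positivity
  · rw [lorentzForm_add_self, lorentzForm_smul_self, lorentzForm_smul_self,
      lorentzForm_smul_right, lorentzForm_comm _ (a • x), lorentzForm_smul_right,
      lorentzForm_comm _ y x]
    positivity

lemma contDiff_lorentzForm_self {n : WithTop ℕ∞} :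
    ContDiff ℝ n fun x : ι → ℝ => lorentzForm i₀ x x := by
  unfold lorentzForm; fun_prop

lemma isOpen_lightCone : IsOpen (lightCone i₀) :=
  (isOpen_lt continuous_const (continuous_apply i₀)).inter
    (isOpen_lt continuous_const (contDiff_lorentzForm_self i₀ (n := 0)).continuous)

lemma smul_single_mem_lightCone {s : ℝ} (hs : 0 < s) :
    s • (Pi.single i₀ 1 : ι → ℝ) ∈ lightCone i₀ := by
  refine ⟨by simpa using hs, ?_⟩
  rw [lorentzForm_smul_self, lorentzForm_eq, Finset.sum_eq_zero]
  · simpa using pow_pos hs 2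
  · intro i hi; simp [Finset.ne_of_mem_erase hi]

lemma lorentzForm_self_eq_zero_of_mem_frontier {p : ι → ℝ} (hp : p ∈ frontier (lightCone i₀)) :
    lorentzForm i₀ p p = 0 := by
  rw [(isOpen_lightCone i₀).frontier_eq] at hp
  have hcl : lightCone i₀ ⊆ {x | 0 ≤ x i₀ ∧ 0 ≤ lorentzForm i₀ x x} :=
    fun x hx => ⟨hx.1.le, hx.2.le⟩
  have hclosed : IsClosed {x : ι → ℝ | 0 ≤ x i₀ ∧ 0 ≤ lorentzForm i₀ x x} :=
    (isClosed_le continuous_const (continuous_apply i₀)).inter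
      (isClosed_le continuous_const (contDiff_lorentzForm_self i₀ (n := 0)).continuous)
  obtain ⟨h0, hq⟩ := closure_minimal hcl hclosed hp.1
  refine le_antisymm (not_lt.mp fun h => hp.2 ⟨h0.lt_of_ne fun h' => ?_, h⟩) hq
  rw [lorentzForm_eq, ← h', zero_mul, zero_sub] at h
  have : 0 ≤ ∑ i ∈ Finset.univ.erase i₀, p i * p i :=
    Finset.sum_nonneg fun i _ => mul_self_nonneg _
  linarith

lemma zero_mem_frontier_lightCone : (0 : ι → ℝ) ∈ frontier (lightCone i₀) := by
  rw [(isOpen_lightCone i₀).frontier_eq]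
  refine ⟨?_, fun h => lt_irrefl _ h.1⟩
  exact mem_closure_of_tendsto (tendsto_smul_single i₀)
    (Eventually.of_forall fun j => smul_single_mem_lightCone i₀ (by positivity))

/-- The polar `x ↦ 2 ⟨x, ·⟩` of the Lorentzian form, i.e. the derivative of `x ↦ ⟨x, x⟩`. -/
noncomputable def lorentzPolar : (ι → ℝ) →L[ℝ] (ι → ℝ) →L[ℝ] ℝ :=
  ∑ i, (2 * lorentzSign i₀ i) •
    (ContinuousLinearMap.proj (R := ℝ) (φ := fun _ : ι => ℝ) i).smulRight
      (ContinuousLinearMap.proj (R := ℝ) (φ := fun _ : ι => ℝ) i)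

lemma lorentzPolar_apply (x y : ι → ℝ) : lorentzPolar i₀ x y = 2 * lorentzForm i₀ x y := by
  simp only [lorentzPolar, lorentzForm, _root_.sum_apply,
    _root_.smul_apply, ContinuousLinearMap.smulRight_apply,
    ContinuousLinearMap.proj_apply, smul_eq_mul, Finset.mul_sum]
  exact Finset.sum_congr rfl fun i _ => by ring

lemma hasFDerivAt_lorentzForm_self (x : ι → ℝ) :
    HasFDerivAt (fun y => lorentzForm i₀ y y) (lorentzPolar i₀ x) x := by
  have h : HasFDerivAt (fun y : ι → ℝ => lorentzForm i₀ y y)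
      (∑ i, lorentzSign i₀ i • ((x i) • (ContinuousLinearMap.proj (R := ℝ) (φ := fun _ : ι => ℝ) i)
        + (x i) • (ContinuousLinearMap.proj (R := ℝ) (φ := fun _ : ι => ℝ) i))) x := by
    unfold lorentzForm
    refine HasFDerivAt.fun_sum fun i _ => ?_
    simp only [mul_assoc]
    exact ((hasFDerivAt_apply i x).mul (hasFDerivAt_apply i x)).const_mul _
  refine h.congr_fderiv (ContinuousLinearMap.ext fun y => ?_)
  rw [lorentzPolar_apply, lorentzForm, Finset.mul_sum]
  simp only [_root_.sum_apply, _root_.smul_apply,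
    _root_.add_apply, ContinuousLinearMap.proj_apply, smul_eq_mul]
  exact Finset.sum_congr rfl fun i _ => by ring

lemma lorentzForm_single_right (x : ι → ℝ) (j : ι) :
    lorentzForm i₀ x (Pi.single j 1) = lorentzSign i₀ j * x j := by
  simp [lorentzForm, Pi.single_apply]

/-- The rank-one operator `y ↦ ⟨x, y⟩ x`. -/
noncomputable def lorentzRankOne (x : ι → ℝ) : Matrix ι ι ℝ :=
  vecMulVec x fun j => lorentzSign i₀ j * x j

lemma dotProduct_sign_mul (x y : ι → ℝ) :
    (fun j => lorentzSign i₀ j * x j) ⬝ᵥ y = lorentzForm i₀ x y := rfl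

lemma lorentzRankOne_mul_self (x : ι → ℝ) :
    lorentzRankOne i₀ x * lorentzRankOne i₀ x = lorentzForm i₀ x x • lorentzRankOne i₀ x := by
  rw [lorentzRankOne, vecMulVec_mul_vecMulVec, dotProduct_sign_mul]
  ext i j
  simp [vecMulVec_apply]
  ring

lemma trace_lorentzRankOne (x : ι → ℝ) :
    (lorentzRankOne i₀ x).trace = lorentzForm i₀ x x := by
  rw [lorentzRankOne, trace_vecMulVec, dotProduct_comm, dotProduct_sign_mul]

lemma det_one_add_smul_lorentzRankOne (c : ℝ) (x : ι → ℝ) :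
    (1 + c • lorentzRankOne i₀ x).det = 1 + c * lorentzForm i₀ x x := by
  rw [lorentzRankOne, ← smul_vecMulVec, vecMulVec_eq Unit,
    det_one_add_replicateCol_mul_replicateRow, dotProduct_smul, dotProduct_sign_mul, smul_eq_mul]

/-- The Hessian of a multiple of a power of the Lorentzian quadratic form. -/
lemma hessian_const_mul_rpow {u : (ι → ℝ) → ℝ} (K r : ℝ)
    (hu : ∀ y ∈ lightCone i₀, u y = K * lorentzForm i₀ y y ^ r)
    {x : ι → ℝ} (hx : x ∈ lightCone i₀) :
    hessian u x = (2 * K * r * lorentzForm i₀ x x ^ (r - 1)) •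
      (diagonal (lorentzSign i₀) *
        (1 + (2 * (r - 1) / lorentzForm i₀ x x) • lorentzRankOne i₀ x)) := by
  have hderiv : ∀ y ∈ lightCone i₀, ∀ s : ℝ, HasFDerivAt (fun y => lorentzForm i₀ y y ^ s)
      ((s * lorentzForm i₀ y y ^ (s - 1)) • lorentzPolar i₀ y) y := fun y hy s =>
    (hasFDerivAt_lorentzForm_self i₀ y).rpow_const (Or.inl hy.2.ne')
  have hfirst : fderiv ℝ u =ᶠ[𝓝 x] fun y =>
      (K * r * lorentzForm i₀ y y ^ (r - 1)) • lorentzPolar i₀ y := by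
    filter_upwards [(isOpen_lightCone i₀).mem_nhds hx] with y hy
    have hev : u =ᶠ[𝓝 y] fun y => K * lorentzForm i₀ y y ^ r := by
      filter_upwards [(isOpen_lightCone i₀).mem_nhds hy] with z hz using hu z hz
    rw [hev.fderiv_eq, ((hderiv y hy r).const_mul K).fderiv, smul_smul, mul_assoc]
  have hsecond := ((hderiv x hx (r - 1)).const_mul (K * r)).smul
    (lorentzPolar i₀).hasFDerivAt
  ext i j
  rw [hessian, of_apply, iteratedFDeriv_two_apply, hfirst.fderiv_eq]
  erw [hsecond.fderiv]
  have hq := hx.2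
  have hpow : lorentzForm i₀ x x ^ (r - 1 - 1) =
      lorentzForm i₀ x x ^ (r - 1) / lorentzForm i₀ x x := Real.rpow_sub_one hq.ne' _
  simp only [hpow, _root_.add_apply, _root_.smul_apply,
    ContinuousLinearMap.smulRight_apply, cons_val_zero, cons_val_one, lorentzPolar_apply,
    lorentzForm_single_right, smul_eq_mul, diagonal_mul, Matrix.smul_apply, Matrix.add_apply,
    lorentzRankOne, vecMulVec_apply, Matrix.one_apply, Pi.single_apply]
  by_cases hij : i = j
  · subst hij
    simp
    ring
  · simp [hij, Ne.symm hij]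
    ring

lemma posDef_hessian_rpow {β : ℝ} (hβ : 0 < β) {x : ι → ℝ} (hx : x ∈ lightCone i₀) :
    (hessian (fun y => lorentzForm i₀ y y ^ (-β)) x).PosDef := by
  rw [hessian_const_mul_rpow i₀ 1 (-β) (fun y _ => (one_mul _).symm) hx]
  have hq := hx.2
  set q := lorentzForm i₀ x x with hqdef
  rw [posDef_iff_dotProduct_mulVec]
  constructor
  · ext i j
    by_cases hij : i = j
    · subst hij; simp
    · simp [hij, Ne.symm hij, diagonal_mul, lorentzRankOne, vecMulVec_apply]
      ring_nf
      simp
  · intro y hy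
    have hval : star y ⬝ᵥ (((2 * 1 * -β * q ^ (-β - 1)) • (diagonal (lorentzSign i₀) *
        (1 + (2 * (-β - 1) / q) • lorentzRankOne i₀ x))) *ᵥ y) =
        (2 * β * q ^ (-β - 1) / q) *
          (2 * (β + 1) * lorentzForm i₀ x y ^ 2 - q * lorentzForm i₀ y y) := by
      rw [smul_mulVec, ← mulVec_mulVec, add_mulVec, one_mulVec, smul_mulVec, lorentzRankOne,
        vecMulVec_mulVec, dotProduct_sign_mul, star_trivial, dotProduct_smul]
      have : ∀ v : ι → ℝ, y ⬝ᵥ (diagonal (lorentzSign i₀) *ᵥ v) = lorentzForm i₀ y v := by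
        intro v
        simp only [dotProduct, mulVec_diagonal, lorentzForm]
        exact Finset.sum_congr rfl fun i _ => by ring
      rw [this, lorentzForm_add_right, lorentzForm_smul_right, op_smul_eq_smul,
        lorentzForm_smul_right, lorentzForm_comm i₀ y x, smul_eq_mul]
      field_simp
      ring
    rw [hval]
    have := lorentzForm_reverse_cauchy_schwarz i₀ hx hy (k := 2 * (β + 1)) (by linarith)
    have h2 : 0 < 2 * (β + 1) * lorentzForm i₀ x y ^ 2 - q * lorentzForm i₀ y y := by
      linarith
    positivity

lemma trace_inv_mul_one_add_smul_lorentzRankOne {a a' c c' : ℝ} (ha : a ≠ 0) (x : ι → ℝ)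
    (hc : 1 + c * lorentzForm i₀ x x ≠ 0) :
    ((a • (diagonal (lorentzSign i₀) * (1 + c • lorentzRankOne i₀ x)))⁻¹ *
      (a' • (diagonal (lorentzSign i₀) * (1 + c' • lorentzRankOne i₀ x)))).trace =
      a⁻¹ * a' * (Fintype.card ι - 1 +
        (1 + c' * lorentzForm i₀ x x) / (1 + c * lorentzForm i₀ x x)) := by
  set q := lorentzForm i₀ x x with hq
  set P := lorentzRankOne i₀ x with hP
  have hPP : P * P = q • P := lorentzRankOne_mul_self i₀ x
  have hD : IsUnit (diagonal (lorentzSign i₀)).det := by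
    rw [det_diagonal, isUnit_iff_ne_zero]
    exact Finset.prod_ne_zero_iff.mpr fun i _ => lorentzSign_ne_zero i₀ i
  have hdet : IsUnit (a • (diagonal (lorentzSign i₀) * (1 + c • P))).det := by
    rw [det_smul, det_mul, det_one_add_smul_lorentzRankOne]
    exact ((IsUnit.mk0 a ha).pow _).mul (hD.mul (IsUnit.mk0 _ hc))
  have hprod : a' • (diagonal (lorentzSign i₀) * (1 + c' • P)) =
      (a • (diagonal (lorentzSign i₀) * (1 + c • P))) *
        ((a⁻¹ * a') • (1 + ((c' - c) / (1 + c * q)) • P)) := by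
    rw [smul_mul_smul_comm, Matrix.mul_assoc]
    have h1 : a * (a⁻¹ * a') = a' := by field_simp
    have h2 : (1 + c • P) * (1 + ((c' - c) / (1 + c * q)) • P) = 1 + c' • P := by
      rw [add_mul, one_mul, mul_add, mul_one, smul_mul_smul_comm, hPP, smul_smul, add_assoc,
        ← add_smul, ← add_smul]
      congr 2
      field_simp
      ring
    rw [h1, h2]
  rw [hprod, nonsing_inv_mul_cancel_left _ _ hdet, trace_smul, trace_add, trace_one, trace_smul,
    trace_lorentzRankOne, smul_eq_mul, smul_eq_mul, ← hq]
  field_simp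
  ring

lemma tendsto_rpow_neg_of_tendsto_frontier {β : ℝ} (hβ : 0 < β) {x : ℕ → ι → ℝ} {p : ι → ℝ}
    (hx : ∀ j, x j ∈ lightCone i₀) (hp : p ∈ frontier (lightCone i₀))
    (hlim : Tendsto x atTop (𝓝 p)) :
    Tendsto (fun j => lorentzForm i₀ (x j) (x j) ^ (-β)) atTop atTop := by
  have h0 : Tendsto (fun j => lorentzForm i₀ (x j) (x j)) atTop (𝓝[>] 0) := by
    refine tendsto_nhdsWithin_iff.mpr ⟨?_, Eventually.of_forall fun j => (hx j).2⟩
    rw [← lorentzForm_self_eq_zero_of_mem_frontier i₀ hp]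
    exact ((contDiff_lorentzForm_self i₀ (n := 0)).continuous.tendsto p).comp hlim
  exact (tendsto_rpow_neg_nhdsGT_zero (neg_neg_of_pos hβ)).comp h0

lemma not_isQuadraticOn_rpow {β : ℝ} (hβ : 0 < β) :
    ¬ IsQuadraticOn (fun x => lorentzForm i₀ x x ^ (-β)) (lightCone i₀) := by
  rintro ⟨A, b, c, h⟩
  set x : ℕ → ι → ℝ := fun j => (1 / ((j : ℝ) + 1)) • Pi.single i₀ 1
  have hx : ∀ j, x j ∈ lightCone i₀ := fun j =>
    smul_single_mem_lightCone i₀ (by positivity)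
  have hlim : Tendsto x atTop (𝓝 0) := tendsto_smul_single i₀
  have htop := tendsto_rpow_neg_of_tendsto_frontier i₀ hβ hx (zero_mem_frontier_lightCone i₀) hlim
  have hcont : Continuous fun x : ι → ℝ =>
      (∑ i, ∑ j, A i j * x i * x j) + (∑ i, b i * x i) + c := by fun_prop
  refine not_tendsto_nhds_of_tendsto_atTop htop _
    (((hcont.tendsto 0).comp hlim).congr fun j => (h _ (hx j)).symm)

/-- If `β` and `θ` are suitably related, the function `⟨x, x⟩ ^ (-β)` solves the affine maximal
type equation with parameter `θ` in the light cone. -/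
lemma affineMaximal_rpow {β θ : ℝ} (hβ : 0 < β)
    (hrel : 2 * (Fintype.card ι * (β + 1) * θ) - 1 = (Fintype.card ι - 1) * (1 + 2 * β))
    {x : ι → ℝ} (hx : x ∈ lightCone i₀) :
    ((hessian (fun y => lorentzForm i₀ y y ^ (-β)) x)⁻¹ *
      hessian (fun y => (hessian (fun y => lorentzForm i₀ y y ^ (-β)) y).det ^ (-θ)) x).trace
      = 0 := by
  set n := Fintype.card ι with hn
  set K : ℝ := (2 * 1 * -β) ^ n * ((diagonal (lorentzSign i₀)).det * -(1 + 2 * β)) with hK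
  have hform : ∀ y ∈ lightCone i₀, (hessian (fun y => lorentzForm i₀ y y ^ (-β)) y).det =
      K * (lorentzForm i₀ y y ^ (-β - 1)) ^ n := by
    intro y hy
    rw [hessian_const_mul_rpow i₀ 1 (-β) (fun y _ => (one_mul _).symm) hy, det_smul, det_mul,
      det_one_add_smul_lorentzRankOne, div_mul_cancel₀ _ hy.2.ne', mul_pow, hK, ← hn]
    ring
  have hKpos : 0 < K := by
    have hpos := (posDef_hessian_rpow i₀ hβ hx).det_pos
    rw [hform x hx] at hpos
    exact pos_of_mul_pos_left hpos (pow_nonneg (Real.rpow_nonneg hx.2.le _) _)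
  have hw : ∀ y ∈ lightCone i₀,
      (hessian (fun y => lorentzForm i₀ y y ^ (-β)) y).det ^ (-θ) =
        K ^ (-θ) * lorentzForm i₀ y y ^ (n * (β + 1) * θ) := by
    intro y hy
    have hq := hy.2
    rw [hform y hy, Real.mul_rpow hKpos.le (by positivity), ← Real.rpow_mul_natCast hq.le,
      ← Real.rpow_mul hq.le]
    congr 2
    ring
  rw [hessian_const_mul_rpow i₀ 1 (-β) (fun y _ => (one_mul _).symm) hx,
    hessian_const_mul_rpow i₀ _ _ hw hx]
  have hq := hx.2
  rw [trace_inv_mul_one_add_smul_lorentzRankOne]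
  · rw [div_mul_cancel₀ _ hq.ne', div_mul_cancel₀ _ hq.ne', ← hn]
    have h1 : (1 : ℝ) + 2 * (n * (β + 1) * θ - 1) = -((n - 1) * (1 + 2 * (-β - 1))) := by
      linear_combination hrel
    have h2 : (1 : ℝ) + 2 * (-β - 1) ≠ 0 := by linarith
    rw [h1, neg_div, mul_div_cancel_right₀ _ h2]
    ring
  · have : lorentzForm i₀ x x ^ (-β - 1) ≠ 0 := (Real.rpow_pos_of_pos hq _).ne'
    exact mul_ne_zero (by linarith) this
  · rw [div_mul_cancel₀ _ hq.ne']
    linarith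

end Lorentz

/-- Failure of the full Bernstein theorem in the sense of Trudinger–Wang: for every
`N ≥ 3` and `θ ∈ (1/2, (N−1)/N)` there is a nonempty open convex `Ω ⊆ ℝ^N` and a
non-quadratic, locally uniformly convex `C⁵` solution `u` of the affine maximal type
equation on `Ω` which blows up at `∂Ω` (so its graph is Euclidean complete). -/
theorem stmt_19 (N : ℕ) (hN : 3 ≤ N) (θ : ℝ)
    (hθ₁ : 1 / 2 < θ) (hθ₂ : θ < ((N:ℝ) - 1) / (N:ℝ)) :
    ∃ Ω : Set (Fin N → ℝ), Ω.Nonempty ∧ IsOpen Ω ∧ Convex ℝ Ω ∧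
      ∃ u : (Fin N → ℝ) → ℝ,
        ContDiffOn ℝ 5 u Ω ∧
        (∀ x ∈ Ω, (hessian u x).PosDef) ∧
        (∀ x ∈ Ω, ((hessian u x)⁻¹
          * hessian (fun y => (hessian u y).det ^ (-θ)) x).trace = 0) ∧
        ¬ IsQuadraticOn u Ω ∧
        (∀ (x : ℕ → (Fin N → ℝ)) (p : Fin N → ℝ),
          (∀ j : ℕ, x j ∈ Ω) → p ∈ frontier Ω →
          Filter.Tendsto x Filter.atTop (nhds p) →
          Filter.Tendsto (fun j => u (x j)) Filter.atTop Filter.atTop) := by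
  let i₀ : Fin N := ⟨0, by omega⟩
  have hN' : (3 : ℝ) ≤ N := by exact_mod_cast hN
  have hden : 0 < (N : ℝ) - 1 - N * θ := by
    rw [lt_div_iff₀ (by linarith)] at hθ₂
    linarith
  set β : ℝ := N * (2 * θ - 1) / (2 * (N - 1 - N * θ)) with hβdef
  have hβ : 0 < β := by
    have : 0 < 2 * θ - 1 := by linarith
    positivity
  refine ⟨lightCone i₀, ⟨_, smul_single_mem_lightCone i₀ one_pos⟩, isOpen_lightCone i₀,
    convex_lightCone i₀, fun x => lorentzForm i₀ x x ^ (-β), ?_,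
    fun x hx => posDef_hessian_rpow i₀ hβ hx, fun x hx => affineMaximal_rpow i₀ hβ ?_ hx,
    not_isQuadraticOn_rpow i₀ hβ,
    fun x p hx hp hlim => tendsto_rpow_neg_of_tendsto_frontier i₀ hβ hx hp hlim⟩
  · exact (contDiff_lorentzForm_self i₀).contDiffOn.rpow_const_of_ne fun x hx => hx.2.ne'
  · rw [Fintype.card_fin, hβdef]
    field_simp
    ring
end
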